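/- Let A ∈ ℝ^{n×d} have rank r and thin SVD A = UΣVᵀ with singular values σ₁ ≥ … ≥ σ_r > 0, let 1 ≤ k < r, set λ = ‖A_{k,⊥}‖_F²/k, and define Σ_λ = diag(σ_i/√(σ_i²+λ)), ridge leverage scores τ_i^λ = ‖(UΣ_λ)_{i*}‖₂², d_λ = Σ_i τ_i^λ, and sampling probabilities p_i = τ_i^λ/d_λ. Let W ∈ ℝ^{s×n} be the random sampling-and-rescaling matrix of Algorithm 1 built from these probabilities, and let ε ∈ (0,1), δ ∈ (0,1). If s ≥ max{ (1 + ε/3) · 4k ln(16(1+2k)/δ)/ε² , 32k/(δ ε²) }, then with probability at least 1 − δ, for every matrix X ∈ ℝ^{d×(d−k)} with XᵀX = I_{d−k}: |‖WAX‖_F² − ‖AX‖_F²| ≤ (4 + 2√2) ε ‖AX‖_F². -/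

import Mathlib

open Matrix BigOperators

noncomputable def frobNorm {m n : Type*} [Fintype m] [Fintype n]
    (A : Matrix m n ℝ) : ℝ := Real.sqrt (∑ i, ∑ j, (A i j) ^ 2)

noncomputable def specNorm {m n : ℕ} (A : Matrix (Fin m) (Fin n) ℝ) : ℝ :=
  ‖LinearMap.toContinuousLinearMap (Matrix.toEuclideanLin A)‖

noncomputable def truncDiag {r : ℕ} (σ : Fin r → ℝ) (m : ℕ) :
    Matrix (Fin r) (Fin r) ℝ :=
  Matrix.diagonal fun i => if (i : ℕ) < m then σ i else 0

noncomputable def samplingMatrix {n : ℕ} (p : Fin n → ℝ) (s : ℕ) (ω : Fin s → Fin n) :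
    Matrix (Fin s) (Fin n) ℝ :=
  fun i j => if j = ω i then 1 / Real.sqrt (s * p j) else 0

noncomputable def expec {n s : ℕ} (p : Fin n → ℝ) (f : (Fin s → Fin n) → ℝ) : ℝ :=
  ∑ ω : Fin s → Fin n, (∏ i, p (ω i)) * f ω

open Classical in
noncomputable def probOf {n s : ℕ} (p : Fin n → ℝ) (E : (Fin s → Fin n) → Prop) : ℝ :=
  ∑ ω : Fin s → Fin n, if E ω then (∏ i, p (ω i)) else 0

def firstCols {n r : ℕ} (U : Matrix (Fin n) (Fin r) ℝ) (k : ℕ) (h : k ≤ r) :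
    Matrix (Fin n) (Fin k) ℝ :=
  fun i j => U i (Fin.castLE h j)

noncomputable def ridgeDiag {r : ℕ} (σ : Fin r → ℝ) (lam : ℝ) :
    Matrix (Fin r) (Fin r) ℝ :=
  Matrix.diagonal fun i => σ i / Real.sqrt (σ i ^ 2 + lam)

theorem norm_pow_sub_pow_le_of_norm_le {𝔸 : Type*} [NormedRing 𝔸] [NormOneClass 𝔸] {x y : 𝔸}
    {c : ℝ} (hc : 1 ≤ c) (hx : ‖x‖ ≤ c) (hy : ‖y‖ ≤ c) (n : ℕ) :
    ‖x ^ n - y ^ n‖ ≤ n * c ^ n * ‖x - y‖ := by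
  have hc0 : 0 ≤ c := zero_le_one.trans hc
  induction n with
  | zero => simp
  | succ n ih =>
    have hsplit : x ^ (n + 1) - y ^ (n + 1) = x ^ n * (x - y) + (x ^ n - y ^ n) * y := by
      rw [pow_succ, pow_succ]; noncomm_ring
    have hxn : ‖x ^ n‖ ≤ c ^ (n + 1) :=
      (norm_pow_le x n).trans <|
        (pow_le_pow_left₀ (norm_nonneg _) hx n).trans (pow_le_pow_right₀ hc n.le_succ)
    calc ‖x ^ (n + 1) - y ^ (n + 1)‖
        ≤ ‖x ^ n‖ * ‖x - y‖ + ‖x ^ n - y ^ n‖ * ‖y‖ := by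
          rw [hsplit]
          exact (norm_add_le _ _).trans (add_le_add (norm_mul_le _ _) (norm_mul_le _ _))
      _ ≤ c ^ (n + 1) * ‖x - y‖ + (n * c ^ n * ‖x - y‖) * c := by gcongr
      _ = ((n + 1 : ℕ) : ℝ) * c ^ (n + 1) * ‖x - y‖ := by push_cast; ring

open Filter Topology Asymptotics in
/-- The **Lie product formula** in a real Banach algebra. -/
theorem tendsto_exp_mul_exp_pow {𝔸 : Type*} [NormedRing 𝔸] [NormOneClass 𝔸] [NormedAlgebra ℝ 𝔸]
    [CompleteSpace 𝔸] (a b : 𝔸) :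
    Tendsto (fun N : ℕ => (NormedSpace.exp ((N : ℝ)⁻¹ • a) * NormedSpace.exp ((N : ℝ)⁻¹ • b)) ^ N)
      atTop (𝓝 (NormedSpace.exp (a + b))) := by
  set f : ℝ → 𝔸 := fun t => NormedSpace.exp (t • a) * NormedSpace.exp (t • b) with hf
  set g : ℝ → 𝔸 := fun t => NormedSpace.exp (t • (a + b)) with hg
  have hfd : HasDerivAt f (a + b) 0 := by
    simpa using! (hasDerivAt_exp_smul_const a (0 : ℝ)).mul (hasDerivAt_exp_smul_const b (0 : ℝ))
  have hgd : HasDerivAt g (a + b) 0 := by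
    simpa only [zero_smul, NormedSpace.exp_zero, one_mul] using
      hasDerivAt_exp_smul_const (a + b) (0 : ℝ)
  have hf0 : f 0 = 1 := by simp [hf]
  have hg0 : g 0 = 1 := by simp [hg]
  have hinv : Tendsto (fun N : ℕ => (N : ℝ)⁻¹) atTop (𝓝 0) := tendsto_inv_atTop_nhds_zero_nat
  have hlin : ∀ h : ℝ → 𝔸, h 0 = 1 → HasDerivAt h (a + b) 0 →
      ∃ C : ℝ, ∀ᶠ N : ℕ in atTop, ‖h (N : ℝ)⁻¹‖ ≤ 1 + C * (N : ℝ)⁻¹ := by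
    intro h h0 hd
    obtain ⟨C, hC⟩ := hd.isBigO_sub.bound
    refine ⟨C, (hinv.eventually hC).mono fun N hN => ?_⟩
    rw [h0, sub_zero, Real.norm_of_nonneg (by positivity)] at hN
    calc ‖h (N : ℝ)⁻¹‖ = ‖1 + (h (N : ℝ)⁻¹ - 1)‖ := by congr 1; abel
      _ ≤ ‖(1 : 𝔸)‖ + ‖h (N : ℝ)⁻¹ - 1‖ := norm_add_le _ _
      _ ≤ 1 + C * (N : ℝ)⁻¹ := by rw [norm_one]; gcongr
  obtain ⟨C₁, hC₁⟩ := hlin f hf0 hfd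
  obtain ⟨C₂, hC₂⟩ := hlin g hg0 hgd
  set C := max 0 (max C₁ C₂) with hC
  have hsmall : Tendsto (fun N : ℕ => (N : ℝ) * ‖f (N : ℝ)⁻¹ - g (N : ℝ)⁻¹‖) atTop (𝓝 0) := by
    have hd : HasDerivAt (fun t => f t - g t) 0 0 := by simpa using! hfd.sub hgd
    have ho := (hasDerivAt_iff_isLittleO.1 hd).comp_tendsto hinv
    have ho' : (fun N : ℕ => f (N : ℝ)⁻¹ - g (N : ℝ)⁻¹) =o[atTop] fun N : ℕ => (N : ℝ)⁻¹ := by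
      simpa [Function.comp_def, hf0, hg0] using! ho
    have := ho'.norm_left.tendsto_div_nhds_zero
    refine this.congr fun N => ?_
    rw [div_inv_eq_mul, mul_comm]
  have hdiff : Tendsto (fun N : ℕ => f (N : ℝ)⁻¹ ^ N - g (N : ℝ)⁻¹ ^ N) atTop (𝓝 0) := by
    refine squeeze_zero_norm' ?_ (by simpa using hsmall.const_mul (Real.exp C))
    filter_upwards [hC₁, hC₂, eventually_gt_atTop 0] with N h₁ h₂ hN
    have hNpos : (0 : ℝ) < N := by exact_mod_cast hN
    have hc : (1 : ℝ) ≤ 1 + C * (N : ℝ)⁻¹ := by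
      have : 0 ≤ C := le_max_left _ _
      have : 0 ≤ C * (N : ℝ)⁻¹ := by positivity
      linarith
    have hmono : ∀ C' ≤ C, 1 + C' * (N : ℝ)⁻¹ ≤ 1 + C * (N : ℝ)⁻¹ := fun C' h => by gcongr
    have hpow : (1 + C * (N : ℝ)⁻¹) ^ N ≤ Real.exp C := by
      calc (1 + C * (N : ℝ)⁻¹) ^ N ≤ Real.exp (C * (N : ℝ)⁻¹) ^ N := by
            gcongr
            rw [add_comm]; exact Real.add_one_le_exp _
        _ = Real.exp C := by
            rw [← Real.exp_nat_mul]; congr 1; field_simp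
    calc ‖f (N : ℝ)⁻¹ ^ N - g (N : ℝ)⁻¹ ^ N‖
        ≤ N * (1 + C * (N : ℝ)⁻¹) ^ N * ‖f (N : ℝ)⁻¹ - g (N : ℝ)⁻¹‖ :=
          norm_pow_sub_pow_le_of_norm_le hc
            (h₁.trans (hmono _ ((le_max_left _ _).trans (le_max_right _ _))))
            (h₂.trans (hmono _ ((le_max_right _ _).trans (le_max_right _ _)))) N
      _ ≤ N * Real.exp C * ‖f (N : ℝ)⁻¹ - g (N : ℝ)⁻¹‖ := by gcongr
      _ = Real.exp C * (N * ‖f (N : ℝ)⁻¹ - g (N : ℝ)⁻¹‖) := by ring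
  have hgpow : ∀ᶠ N : ℕ in atTop, g (N : ℝ)⁻¹ ^ N = NormedSpace.exp (a + b) := by
    filter_upwards [eventually_gt_atTop 0] with N hN
    have hNpos : (N : ℝ) ≠ 0 := by exact_mod_cast hN.ne'
    let : NormedAlgebra ℚ 𝔸 := NormedAlgebra.restrictScalars ℚ ℝ 𝔸
    rw [hg, ← NormedSpace.exp_nsmul, ← Nat.cast_smul_eq_nsmul ℝ, smul_smul,
      mul_inv_cancel₀ hNpos, one_smul]
  have := hdiff.add (tendsto_const_nhds.congr' (hgpow.mono fun N h => h.symm))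
  simpa [hf] using this

section TraceInequalities

variable {ι : Type*} [Fintype ι]

theorem Matrix.two_mul_trace_mul_le (A B : Matrix ι ι ℝ) :
    2 * (A * B).trace ≤ (A * Aᵀ).trace + (B * Bᵀ).trace := by
  have h : 0 ≤ ((A - Bᵀ) * (A - Bᵀ)ᵀ).trace := by
    simpa using (posSemidef_self_mul_conjTranspose (A - Bᵀ)).trace_nonneg
  have e : (Bᵀ * Aᵀ).trace = (A * B).trace := by rw [← transpose_mul, trace_transpose]
  have e' : (Bᵀ * B).trace = (B * Bᵀ).trace := trace_mul_comm _ _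
  simp only [transpose_sub, transpose_transpose, sub_mul, mul_sub, trace_sub] at h
  linarith

variable [DecidableEq ι]

theorem Matrix.trace_mul_pow_comm (A B : Matrix ι ι ℝ) (m : ℕ) :
    ((A * B) ^ m).trace = ((B * A) ^ m).trace := by
  cases m with
  | zero => simp
  | succ m =>
    rw [pow_succ, ← mul_assoc, mul_pow_mul, trace_mul_comm, ← mul_assoc, ← pow_succ']

theorem Matrix.trace_pow_two_pow_le_aux (m : ℕ) :
    (∀ M : Matrix ι ι ℝ, (M ^ 2 ^ (m + 1)).trace ≤ ((M * Mᵀ) ^ 2 ^ m).trace) ∧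
    (∀ X Y : Matrix ι ι ℝ, X.IsSymm → Y.IsSymm →
      ((X * Y) ^ 2 ^ m).trace ≤ (X ^ 2 ^ m * Y ^ 2 ^ m).trace) := by
  induction m with
  | zero =>
    refine ⟨fun M => ?_, fun X Y _ _ => by simp⟩
    have := two_mul_trace_mul_le M M
    simp only [zero_add, pow_one, pow_zero, pow_two]
    linarith
  | succ m ih =>
    obtain ⟨ihM, ihXY⟩ := ih
    refine ⟨fun M => ?_, fun X Y hX hY => ?_⟩
    · have h₁ := ihM (M ^ 2)
      rw [← pow_mul, ← pow_succ'] at h₁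
      have h₂ : ((M ^ 2 * (M ^ 2)ᵀ) ^ 2 ^ m).trace = (((Mᵀ * M) * (M * Mᵀ)) ^ 2 ^ m).trace := by
        have e : M ^ 2 * (M ^ 2)ᵀ = (M * (M * Mᵀ)) * Mᵀ := by
          rw [pow_two, transpose_mul]; noncomm_ring
        rw [e, trace_mul_pow_comm, ← mul_assoc]
      have h₃ := ihXY (Mᵀ * M) (M * Mᵀ) (by simp [IsSymm]) (by simp [IsSymm])
      have h₄ := two_mul_trace_mul_le ((Mᵀ * M) ^ 2 ^ m) ((M * Mᵀ) ^ 2 ^ m)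
      simp only [transpose_pow, transpose_mul, transpose_transpose, ← pow_add, ← two_mul,
        ← pow_succ'] at h₄
      rw [trace_mul_pow_comm Mᵀ M] at h₄
      linarith
    · have h₁ := ihM (X * Y)
      have e : (X * Y) * (X * Y)ᵀ = (X * Y ^ 2) * X := by
        rw [transpose_mul, hX.eq, hY.eq, pow_two]; noncomm_ring
      rw [e, trace_mul_pow_comm (X * Y ^ 2), ← mul_assoc, ← pow_two] at h₁
      have h₂ := ihXY (X ^ 2) (Y ^ 2) (hX.pow 2) (hY.pow 2)
      rw [← pow_mul, ← pow_mul, ← pow_succ'] at h₂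
      exact h₁.trans h₂

open Filter Topology in
/-- The **Golden–Thompson inequality** for real symmetric matrices. -/
theorem Matrix.IsSymm.trace_exp_add_le {H K : Matrix ι ι ℝ} (hH : H.IsSymm) (hK : K.IsSymm) :
    (NormedSpace.exp (H + K)).trace ≤ (NormedSpace.exp H * NormedSpace.exp K).trace := by
  cases isEmpty_or_nonempty ι with
  | inl h => simp [Matrix.trace]
  | inr h =>
  let : NormedRing (Matrix ι ι ℝ) := Matrix.linftyOpNormedRing
  let : NormedAlgebra ℝ (Matrix ι ι ℝ) := Matrix.linftyOpNormedAlgebra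
  have : NormOneClass (Matrix ι ι ℝ) := Matrix.linfty_opNormOneClass
  have hlim := ((tendsto_exp_mul_exp_pow H K).comp
    (tendsto_pow_atTop_atTop_of_one_lt (α := ℕ) one_lt_two))
  have htr : Continuous (Matrix.trace : Matrix ι ι ℝ → ℝ) := continuous_id.matrix_trace
  refine le_of_tendsto ((htr.tendsto _).comp hlim) (Eventually.of_forall fun m => ?_)
  have hsymm : ∀ {G : Matrix ι ι ℝ}, G.IsSymm →
      (NormedSpace.exp (((2 ^ m : ℕ) : ℝ)⁻¹ • G)).IsSymm :=
    fun hG => (hG.smul _).exp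
  have hpow : ∀ G : Matrix ι ι ℝ,
      NormedSpace.exp (((2 ^ m : ℕ) : ℝ)⁻¹ • G) ^ 2 ^ m = NormedSpace.exp G := fun G => by
    rw [← Matrix.exp_nsmul, ← Nat.cast_smul_eq_nsmul ℝ, smul_smul,
      mul_inv_cancel₀ (by positivity), one_smul]
  have := (trace_pow_two_pow_le_aux m).2 _ _ (hsymm hH) (hsymm hK)
  rwa [hpow, hpow] at this

theorem Matrix.PosSemidef.trace_mul_nonneg {P Q : Matrix ι ι ℝ} (hP : P.PosSemidef)
    (hQ : Q.PosSemidef) : 0 ≤ (P * Q).trace := by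
  obtain ⟨B, rfl⟩ : ∃ B : Matrix ι ι ℝ, P = Bᴴ * B := by
    open scoped MatrixOrder in
    exact CStarAlgebra.nonneg_iff_eq_star_mul_self.1 hP.nonneg
  rw [mul_assoc, trace_mul_comm]
  exact (hQ.mul_mul_conjTranspose_same B).trace_nonneg

theorem Matrix.IsSymm.exists_eq_mul_diagonal_mul_transpose {X : Matrix ι ι ℝ} (hX : X.IsSymm) :
    ∃ (Q : Matrix ι ι ℝ) (e : ι → ℝ), Q * Qᵀ = 1 ∧ Qᵀ * Q = 1 ∧ X = Q * diagonal e * Qᵀ := by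
  have hH : X.IsHermitian := by simpa [IsHermitian] using hX.eq
  refine ⟨hH.eigenvectorUnitary, hH.eigenvalues, ?_, ?_, ?_⟩
  · simpa [star_eq_conjTranspose] using Unitary.coe_mul_star_self hH.eigenvectorUnitary
  · simpa [star_eq_conjTranspose] using Unitary.coe_star_mul_self hH.eigenvectorUnitary
  · simpa [Unitary.conjStarAlgAut_apply, star_eq_conjTranspose, Function.comp_def] using!
      hH.spectral_theorem

section Spectral

variable {Q : Matrix ι ι ℝ}

theorem Matrix.exp_mul_diagonal_mul_transpose (h₁ : Q * Qᵀ = 1) (e : ι → ℝ) :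
    NormedSpace.exp (Q * diagonal e * Qᵀ) = Q * diagonal (fun i => Real.exp (e i)) * Qᵀ := by
  have hinv : Q⁻¹ = Qᵀ := inv_eq_right_inv h₁
  have hunit : IsUnit Q := (isUnit_iff_isUnit_det Q).2 (isUnit_det_of_right_inverse h₁)
  rw [← hinv, exp_conj Q _ hunit, exp_diagonal]
  congr 3
  funext i
  rw [Pi.coe_exp, Real.exp_eq_exp_ℝ]

theorem Matrix.posSemidef_mul_diagonal_mul_transpose {e : ι → ℝ} (he : ∀ i, 0 ≤ e i) :
    (Q * diagonal e * Qᵀ).PosSemidef := by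
  simpa using (PosSemidef.diagonal (R := ℝ) (d := e) he).mul_mul_conjTranspose_same Q

theorem Matrix.trace_mul_diagonal_mul_transpose (h₂ : Qᵀ * Q = 1) (e : ι → ℝ) :
    (Q * diagonal e * Qᵀ).trace = ∑ i, e i := by
  rw [trace_mul_comm, ← mul_assoc, h₂, one_mul, trace_diagonal]

theorem Matrix.neg_mul_diagonal_mul_transpose (e : ι → ℝ) :
    -(Q * diagonal e * Qᵀ) = Q * diagonal (fun i => -e i) * Qᵀ := by
  rw [← neg_mul, ← mul_neg, diagonal_neg]

theorem Matrix.exp_add_exp_neg_sub_two_mul_diagonal_mul_transpose (h₁ : Q * Qᵀ = 1) (e : ι → ℝ) :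
    NormedSpace.exp (Q * diagonal e * Qᵀ) + NormedSpace.exp (-(Q * diagonal e * Qᵀ)) - (2 : ℝ) • 1 =
      Q * diagonal (fun i => Real.exp (e i) + Real.exp (-e i) - 2) * Qᵀ := by
  rw [neg_mul_diagonal_mul_transpose, exp_mul_diagonal_mul_transpose h₁,
    exp_mul_diagonal_mul_transpose h₁]
  have h2 : (2 : ℝ) • (1 : Matrix ι ι ℝ) = Q * diagonal (fun _ => (2 : ℝ)) * Qᵀ := by
    rw [← smul_one_eq_diagonal, Matrix.mul_smul, mul_one, smul_mul, h₁]
  rw [h2, ← add_mul, ← sub_mul, ← mul_add, ← mul_sub, diagonal_add, diagonal_sub]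

theorem Matrix.dotProduct_mul_diagonal_mul_transpose_mulVec (e z : ι → ℝ) :
    z ⬝ᵥ (Q * diagonal e * Qᵀ) *ᵥ z = ∑ i, e i * (Qᵀ *ᵥ z) i ^ 2 := by
  rw [← mulVec_mulVec, ← mulVec_mulVec, dotProduct_mulVec, ← mulVec_transpose]
  simp only [dotProduct, mulVec_diagonal]
  exact Finset.sum_congr rfl fun i _ => by ring

theorem Matrix.sum_transpose_mulVec_sq (h₁ : Q * Qᵀ = 1) (z : ι → ℝ) :
    ∑ i, (Qᵀ *ᵥ z) i ^ 2 = z ⬝ᵥ z := by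
  have := dotProduct_mul_diagonal_mul_transpose_mulVec (Q := Q) (fun _ => 1) z
  rw [diagonal_one, mul_one, h₁, one_mulVec] at this
  simpa using this.symm

end Spectral

theorem Matrix.IsSymm.posSemidef_exp {X : Matrix ι ι ℝ} (hX : X.IsSymm) :
    (NormedSpace.exp X).PosSemidef := by
  obtain ⟨Q, e, h₁, h₂, rfl⟩ := hX.exists_eq_mul_diagonal_mul_transpose
  rw [exp_mul_diagonal_mul_transpose h₁]
  exact posSemidef_mul_diagonal_mul_transpose fun i => (Real.exp_pos _).le

theorem Real.two_le_exp_add_exp_neg (x : ℝ) : 2 ≤ Real.exp x + Real.exp (-x) := by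
  have := Real.one_le_cosh x
  rw [Real.cosh_eq] at this
  linarith

theorem Matrix.IsSymm.posSemidef_exp_add_exp_neg_sub_two {X : Matrix ι ι ℝ} (hX : X.IsSymm) :
    (NormedSpace.exp X + NormedSpace.exp (-X) - (2 : ℝ) • 1).PosSemidef := by
  obtain ⟨Q, e, h₁, h₂, rfl⟩ := hX.exists_eq_mul_diagonal_mul_transpose
  rw [exp_add_exp_neg_sub_two_mul_diagonal_mul_transpose h₁]
  exact posSemidef_mul_diagonal_mul_transpose fun i => by
    linarith [Real.two_le_exp_add_exp_neg (e i)]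

/-- Either the quadratic form of a symmetric matrix `X` is bounded by `t`, or the trace of
`2 (cosh X - 1)` is at least `2 (cosh t - 1)`. -/
theorem Matrix.IsSymm.quadratic_le_or_le_trace_exp {X : Matrix ι ι ℝ} (hX : X.IsSymm) {t : ℝ}
    (ht : 0 ≤ t) :
    (∀ z : ι → ℝ, |z ⬝ᵥ X *ᵥ z| ≤ t * (z ⬝ᵥ z)) ∨
      Real.exp t + Real.exp (-t) - 2 ≤
        (NormedSpace.exp X + NormedSpace.exp (-X) - (2 : ℝ) • 1).trace := by
  obtain ⟨Q, e, h₁, h₂, rfl⟩ := hX.exists_eq_mul_diagonal_mul_transpose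
  by_cases h : ∀ i, |e i| ≤ t
  · left
    intro z
    rw [dotProduct_mul_diagonal_mul_transpose_mulVec, ← sum_transpose_mulVec_sq h₁, Finset.mul_sum]
    refine (Finset.abs_sum_le_sum_abs _ _).trans (Finset.sum_le_sum fun i _ => ?_)
    rw [abs_mul, abs_of_nonneg (sq_nonneg ((Qᵀ *ᵥ z) i))]
    exact mul_le_mul_of_nonneg_right (h i) (sq_nonneg _)
  · right
    push Not at h
    obtain ⟨i, hi⟩ := h
    rw [exp_add_exp_neg_sub_two_mul_diagonal_mul_transpose h₁, trace_mul_diagonal_mul_transpose h₂]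
    have hsingle := Finset.single_le_sum (f := fun i => Real.exp (e i) + Real.exp (-e i) - 2)
      (fun j _ => by linarith [Real.two_le_exp_add_exp_neg (e j)]) (Finset.mem_univ i)
    have hcosh : Real.cosh t ≤ Real.cosh (e i) :=
      Real.cosh_le_cosh.2 (by rw [abs_of_nonneg ht]; exact hi.le)
    rw [Real.cosh_eq, Real.cosh_eq] at hcosh
    linarith

theorem Real.exp_le_pade {x : ℝ} (hx : 0 ≤ x) :
    (6 - 2 * x) * Real.exp x ≤ 6 + 4 * x + x ^ 2 := by
  have hderiv : ∀ y : ℝ, HasDerivAt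
      (fun y => (6 + 4 * y + y ^ 2) * Real.exp (-y) + 2 * y)
      (2 - (2 + 2 * y + y ^ 2) * Real.exp (-y)) y := by
    intro y
    have h₁ : HasDerivAt (fun y : ℝ => 6 + 4 * y + y ^ 2) (4 + 2 * y) y := by
      simpa using! (((hasDerivAt_id y).const_mul 4).const_add 6).add (hasDerivAt_pow 2 y)
    have h₂ : HasDerivAt (fun y : ℝ => Real.exp (-y)) (-Real.exp (-y)) y := by
      simpa using! (hasDerivAt_neg y).exp
    have h₃ : HasDerivAt (fun y : ℝ => 2 * y) 2 y := by
      simpa using! (hasDerivAt_id y).const_mul 2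
    convert! (h₁.mul h₂).add h₃ using 1
    ring
  have hmono : MonotoneOn (fun y => (6 + 4 * y + y ^ 2) * Real.exp (-y) + 2 * y) (Set.Ici 0) := by
    refine monotoneOn_of_deriv_nonneg (convex_Ici 0)
      (fun y _ => (hderiv y).continuousAt.continuousWithinAt)
      (fun y _ => (hderiv y).differentiableAt.differentiableWithinAt) fun y hy => ?_
    rw [(hderiv y).deriv]
    rw [interior_Ici] at hy
    have hq := Real.quadratic_le_exp_of_nonneg (le_of_lt hy : 0 ≤ y)
    have hexp : Real.exp y * Real.exp (-y) = 1 := by rw [← Real.exp_add]; simp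
    nlinarith [Real.exp_pos (-y)]
  have h := hmono Set.self_mem_Ici hx hx
  have hexp : Real.exp x * Real.exp (-x) = 1 := by rw [← Real.exp_add]; simp
  simp only at h
  norm_num at h
  nlinarith [Real.exp_pos x]

theorem Real.exp_le_one_add_add_mul_sq {x L : ℝ} (hL : L < 3) (hx : |x| ≤ L) :
    Real.exp x ≤ 1 + x + (1 / (2 * (1 - L / 3))) * x ^ 2 := by
  have habs : Real.exp x - x ≤ Real.exp |x| - |x| := by
    rcases le_total 0 x with h | h
    · rw [abs_of_nonneg h]
    · have := Real.self_le_sinh_iff.2 (neg_nonneg.2 h)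
      rw [Real.sinh_eq, neg_neg] at this
      rw [abs_of_nonpos h]
      linarith
  have hpos : 0 < 6 - 2 * |x| := by linarith
  have hp := Real.exp_le_pade (abs_nonneg x)
  have h₁ : Real.exp |x| ≤ 1 + |x| + (1 / (2 * (1 - |x| / 3))) * x ^ 2 := by
    have e : 1 + |x| + (1 / (2 * (1 - |x| / 3))) * x ^ 2 =
        (6 + 4 * |x| + |x| ^ 2) / (6 - 2 * |x|) := by
      have h₆ : 2 * (1 - |x| / 3) = (6 - 2 * |x|) / 3 := by ring
      have h₇ : 3 / (6 - 2 * |x|) * |x| ^ 2 * (6 - 2 * |x|) = 3 * |x| ^ 2 := by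
        rw [mul_right_comm, div_mul_cancel₀ _ hpos.ne']
      rw [← sq_abs x, h₆, eq_div_iff hpos.ne', one_div_div, add_mul, h₇]
      ring
    rw [e, le_div_iff₀ hpos]
    linarith
  have h₂ : 1 / (2 * (1 - |x| / 3)) * x ^ 2 ≤ 1 / (2 * (1 - L / 3)) * x ^ 2 := by
    have : 0 < 1 - L / 3 := by linarith
    gcongr
  linarith

theorem Matrix.IsSymm.posSemidef_one_add_add_sub_exp {X : Matrix ι ι ℝ} (hX : X.IsSymm) {L : ℝ}
    (hL : L < 3) (h : ∀ z : ι → ℝ, |z ⬝ᵥ X *ᵥ z| ≤ L * (z ⬝ᵥ z)) :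
    (1 + X + (1 / (2 * (1 - L / 3))) • (X * X) - NormedSpace.exp X).PosSemidef := by
  obtain ⟨Q, e, h₁, h₂, rfl⟩ := hX.exists_eq_mul_diagonal_mul_transpose
  have he : ∀ i, |e i| ≤ L := by
    intro i
    have hi := h (Q *ᵥ Pi.single i 1)
    rw [← sum_transpose_mulVec_sq h₁, dotProduct_mul_diagonal_mul_transpose_mulVec, mulVec_mulVec,
      h₂, one_mulVec] at hi
    simpa [Pi.single_apply] using hi
  have hsq : (Q * diagonal e * Qᵀ) * (Q * diagonal e * Qᵀ)
      = Q * diagonal (fun i => e i ^ 2) * Qᵀ := by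
    calc (Q * diagonal e * Qᵀ) * (Q * diagonal e * Qᵀ)
        = Q * diagonal e * (Qᵀ * Q) * diagonal e * Qᵀ := by noncomm_ring
      _ = Q * (diagonal e * diagonal e) * Qᵀ := by rw [h₂]; noncomm_ring
      _ = _ := by rw [diagonal_mul_diagonal]; simp only [pow_two]
  have hone : (1 : Matrix ι ι ℝ) = Q * diagonal (fun _ => (1 : ℝ)) * Qᵀ := by
    rw [diagonal_one, mul_one, h₁]
  rw [hsq, exp_mul_diagonal_mul_transpose h₁]
  nth_rw 1 [hone]
  rw [← smul_mul, ← Matrix.mul_smul, ← diagonal_smul, ← add_mul, ← mul_add, ← add_mul, ← mul_add,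
    ← sub_mul, ← mul_sub, diagonal_add, diagonal_add, diagonal_sub]
  refine posSemidef_mul_diagonal_mul_transpose fun i => ?_
  have := Real.exp_le_one_add_add_mul_sq hL (he i)
  simpa using this

end TraceInequalities

section Expectation

variable {n s : ℕ} {p : Fin n → ℝ}

theorem expec_succ (p : Fin n → ℝ) (f : (Fin (s + 1) → Fin n) → ℝ) :
    expec p f = ∑ j, p j * expec p (fun ω : Fin s → Fin n => f (Fin.cons j ω)) := by
  unfold expec
  rw [← (Fin.consEquiv fun _ => Fin n).sum_comp, Fintype.sum_prod_type]
  refine Finset.sum_congr rfl fun j _ => ?_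
  rw [Finset.mul_sum]
  refine Finset.sum_congr rfl fun ω _ => ?_
  simp [Fin.consEquiv, Fin.prod_univ_succ, mul_assoc]

theorem expec_add (f g : (Fin s → Fin n) → ℝ) :
    expec p (fun ω => f ω + g ω) = expec p f + expec p g := by
  simp only [expec, mul_add, Finset.sum_add_distrib]

theorem expec_const_mul (c : ℝ) (f : (Fin s → Fin n) → ℝ) :
    expec p (fun ω => c * f ω) = c * expec p f := by
  simp only [expec, Finset.mul_sum]
  exact Finset.sum_congr rfl fun ω _ => by ring

theorem expec_sum {κ : Type*} (t : Finset κ) (f : κ → (Fin s → Fin n) → ℝ) :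
    expec p (fun ω => ∑ i ∈ t, f i ω) = ∑ i ∈ t, expec p (f i) := by
  simp only [expec, Finset.mul_sum]
  exact Finset.sum_comm

theorem expec_mono (hp : ∀ j, 0 ≤ p j) {f g : (Fin s → Fin n) → ℝ} (h : ∀ ω, f ω ≤ g ω) :
    expec p f ≤ expec p g :=
  Finset.sum_le_sum fun ω _ =>
    mul_le_mul_of_nonneg_left (h ω) (Finset.prod_nonneg fun i _ => hp (ω i))

theorem expec_const (hsum : ∑ j, p j = 1) (c : ℝ) :
    expec p (fun _ : Fin s → Fin n => c) = c := by
  induction s with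
  | zero => simp [expec]
  | succ s ih => rw [expec_succ]; simp only [ih, ← Finset.sum_mul, hsum, one_mul]

theorem expec_sq_sum (hsum : ∑ j, p j = 1) {f : Fin n → ℝ} (hf : ∑ j, p j * f j = 0) :
    expec p (fun ω : Fin s → Fin n => (∑ t, f (ω t)) ^ 2) = s * ∑ j, p j * f j ^ 2 := by
  induction s with
  | zero => simp [expec]
  | succ s ih =>
    rw [expec_succ]
    set m := expec p (fun ω : Fin s → Fin n => ∑ t, f (ω t)) with hm
    have hstep : ∀ j, expec p (fun ω : Fin s → Fin n =>
        (∑ t, f ((Fin.cons j ω : Fin (s + 1) → Fin n) t)) ^ 2) =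
        f j ^ 2 + (2 * f j) * m + s * ∑ j, p j * f j ^ 2 := by
      intro j
      rw [← ih, hm, ← expec_const_mul, ← expec_const (s := s) hsum (f j ^ 2), ← expec_add,
        ← expec_add]
      congr 1
      funext ω
      rw [Fin.sum_univ_succ]
      simp only [Fin.cons_zero, Fin.cons_succ]
      ring
    have hcross : ∑ j, p j * (2 * f j * m) = 0 := by
      have : ∀ j, p j * (2 * f j * m) = (p j * f j) * (2 * m) := fun j => by ring
      simp only [this, ← Finset.sum_mul, hf, zero_mul]
    simp only [hstep, mul_add, Finset.sum_add_distrib, hcross, ← Finset.sum_mul, hsum]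
    push_cast
    ring

theorem one_sub_expec_le_probOf (hp : ∀ j, 0 ≤ p j) (hsum : ∑ j, p j = 1)
    {f : (Fin s → Fin n) → ℝ} {E : (Fin s → Fin n) → Prop} (hf : ∀ ω, 0 ≤ f ω)
    (h : ∀ ω, f ω < 1 → E ω) : 1 - expec p f ≤ probOf p E := by
  classical
  have hE : probOf p E = expec p (fun ω => if E ω then 1 else 0) := by
    simp only [probOf, expec, mul_ite, mul_one, mul_zero]
  have hmono : expec p (fun _ : Fin s → Fin n => (1 : ℝ)) ≤
      expec p (fun ω => f ω + if E ω then 1 else 0) := by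
    refine expec_mono hp fun ω => ?_
    by_cases hω : E ω
    · simpa [hω] using hf ω
    · simpa [hω] using not_lt.1 (mt (h ω) hω)
  rw [expec_const hsum, expec_add] at hmono
  rw [hE]
  linarith

variable {ι : Type*} [Fintype ι] [DecidableEq ι]

theorem sum_trace_exp_add_le (hp : ∀ j, 0 ≤ p j) (hsum : ∑ j, p j = 1)
    {X : Fin n → Matrix ι ι ℝ} (hX : ∀ j, (X j).IsSymm) (hmean : ∑ j, p j • X j = 0) {g : ℝ}
    (hg : 0 ≤ g) (hexp : ∀ j, (1 + X j + g • (X j * X j) - NormedSpace.exp (X j)).PosSemidef)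
    {V : Matrix ι ι ℝ} (hV : (V - ∑ j, p j • (X j * X j)).PosSemidef)
    {S : Matrix ι ι ℝ} (hS : S.IsSymm) :
    ∑ j, p j * (NormedSpace.exp (X j + S)).trace ≤
      (NormedSpace.exp S).trace + g * (V * NormedSpace.exp S).trace := by
  set e := NormedSpace.exp S with he
  have hePSD : e.PosSemidef := hS.posSemidef_exp
  have h₁ : ∀ j, (NormedSpace.exp (X j + S)).trace ≤
      e.trace + (X j * e).trace + g * ((X j * X j) * e).trace := fun j => by
    have hgt := (hX j).trace_exp_add_le hS
    have := (hexp j).trace_mul_nonneg hePSD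
    simp only [sub_mul, add_mul, one_mul, smul_mul, trace_sub, trace_add, trace_smul,
      smul_eq_mul] at this
    linarith
  have hlin : ∑ j, p j * (X j * e).trace = 0 := by
    have := congrArg (fun M => (M * e).trace) hmean
    simpa [Finset.sum_mul, trace_sum] using this
  have hquad : ∑ j, p j * ((X j * X j) * e).trace ≤ (V * e).trace := by
    have := hV.trace_mul_nonneg hePSD
    simp only [sub_mul, Finset.sum_mul, smul_mul, trace_sub, trace_sum, trace_smul,
      smul_eq_mul] at this
    linarith
  calc ∑ j, p j * (NormedSpace.exp (X j + S)).trace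
      ≤ ∑ j, p j * (e.trace + (X j * e).trace + g * ((X j * X j) * e).trace) :=
        Finset.sum_le_sum fun j _ => mul_le_mul_of_nonneg_left (h₁ j) (hp j)
    _ = e.trace + g * ∑ j, p j * ((X j * X j) * e).trace := by
        have hcomm : ∀ j, p j * (g * ((X j * X j) * e).trace) =
            g * (p j * ((X j * X j) * e).trace) := fun j => by ring
        simp only [mul_add, Finset.sum_add_distrib, hlin, ← Finset.sum_mul, hsum, hcomm,
          ← Finset.mul_sum]
        ring
    _ ≤ _ := by gcongr

/-- A matrix Bernstein moment bound with intrinsic dimension: the number `D` bounds the ratio of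
the trace of the variance proxy `V` to the bound `v` on its norm. -/
theorem expec_trace_exp_sum_le (hp : ∀ j, 0 ≤ p j) (hsum : ∑ j, p j = 1)
    {X : Fin n → Matrix ι ι ℝ} (hX : ∀ j, (X j).IsSymm) (hmean : ∑ j, p j • X j = 0) {g v D : ℝ}
    (hg : 0 ≤ g) (hv : 0 ≤ v)
    (hexp : ∀ j, (1 + X j + g • (X j * X j) - NormedSpace.exp (X j)).PosSemidef)
    (hexp' : ∀ j, (1 + -X j + g • (X j * X j) - NormedSpace.exp (-X j)).PosSemidef)
    {V : Matrix ι ι ℝ} (hV : (V - ∑ j, p j • (X j * X j)).PosSemidef)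
    (hVv : (v • (1 : Matrix ι ι ℝ) - V).PosSemidef) (hVD : V.trace ≤ v * D) :
    expec p (fun ω : Fin s → Fin n => (NormedSpace.exp (∑ t, X (ω t)) +
      NormedSpace.exp (-∑ t, X (ω t)) - (2 : ℝ) • 1).trace) ≤ 2 * D * ((1 + g * v) ^ s - 1) := by
  induction s with
  | zero => simp [expec, two_mul]
  | succ s ih =>
    set F : Matrix ι ι ℝ → ℝ := fun S =>
      (NormedSpace.exp S + NormedSpace.exp (-S) - (2 : ℝ) • 1).trace with hF
    have hstep : ∀ S : Matrix ι ι ℝ, S.IsSymm →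
        ∑ j, p j * F (X j + S) ≤ 2 * (g * v * D) + (1 + g * v) * F S := by
      intro S hS
      have h₁ := sum_trace_exp_add_le hp hsum hX hmean hg hexp hV hS
      have h₂ := sum_trace_exp_add_le (X := fun j => -X j) hp hsum (fun j => (hX j).neg)
        (by simp [hmean]) hg (by simpa using hexp') (by simpa using hV) hS.neg
      have h₃ := hVv.trace_mul_nonneg hS.posSemidef_exp_add_exp_neg_sub_two
      simp only [← neg_add] at h₂
      simp only [hF, sub_mul, mul_add, mul_sub, smul_mul, one_mul, Matrix.mul_smul, mul_one,
        trace_add, trace_sub, trace_smul, trace_one, smul_eq_mul, Finset.sum_add_distrib,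
        Finset.sum_sub_distrib, ← Finset.sum_mul, hsum] at h₁ h₂ h₃ ⊢
      have h₄ := mul_le_mul_of_nonneg_left hVD hg
      have h₅ := mul_nonneg hg h₃
      nlinarith
    have hsymm : ∀ ω : Fin s → Fin n, (∑ t, X (ω t)).IsSymm := fun ω => by
      rw [IsSymm, transpose_sum]
      exact Finset.sum_congr rfl fun t _ => hX _
    calc expec p (fun ω : Fin (s + 1) → Fin n => F (∑ t, X (ω t)))
        = expec p (fun ω : Fin s → Fin n => ∑ j, p j * F (X j + ∑ t, X (ω t))) := by
          rw [expec_succ, expec_sum]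
          refine Finset.sum_congr rfl fun j _ => ?_
          rw [expec_const_mul]
          simp only [Fin.sum_univ_succ, Fin.cons_zero, Fin.cons_succ]
      _ ≤ expec p (fun ω : Fin s → Fin n =>
            2 * (g * v * D) + (1 + g * v) * F (∑ t, X (ω t))) :=
          expec_mono hp fun ω => hstep _ (hsymm ω)
      _ = 2 * (g * v * D) + (1 + g * v) * expec p (fun ω : Fin s → Fin n => F (∑ t, X (ω t))) := by
          rw [expec_add, expec_const hsum, expec_const_mul]
      _ ≤ 2 * (g * v * D) + (1 + g * v) * (2 * D * ((1 + g * v) ^ s - 1)) := by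
          have : 0 ≤ 1 + g * v := by positivity
          gcongr
      _ = 2 * D * ((1 + g * v) ^ (s + 1) - 1) := by ring

end Expectation

section Deterministic

variable {ι κ μ : Type*} [Fintype ι] [Fintype κ] [Fintype μ]

theorem Matrix.abs_trace_mul_transpose_mul_le {K : Matrix ι ι ℝ} {ε : ℝ} {c : ι → ℝ}
    (hK : ∀ y : ι → ℝ, |y ⬝ᵥ K *ᵥ y| ≤ ε * ∑ i, c i * y i ^ 2) (B : Matrix ι κ ℝ) :
    |(B * Bᵀ * K).trace| ≤ ε * ∑ i, c i * (B * Bᵀ) i i := by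
  have h₁ : (B * Bᵀ * K).trace = ∑ a, (fun i => B i a) ⬝ᵥ K *ᵥ (fun i => B i a) := by
    rw [Matrix.mul_assoc, trace_mul_comm, trace]
    refine Finset.sum_congr rfl fun a _ => ?_
    rw [diag_apply, Matrix.mul_assoc]
    rfl
  have h₂ : ∑ i, c i * (B * Bᵀ) i i = ∑ a, ∑ i, c i * B i a ^ 2 := by
    rw [Finset.sum_comm]
    refine Finset.sum_congr rfl fun i _ => ?_
    rw [mul_apply, Finset.mul_sum]
    exact Finset.sum_congr rfl fun a _ => by rw [transpose_apply]; ring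
  rw [h₁, h₂, Finset.mul_sum]
  exact (Finset.abs_sum_le_sum_abs _ _).trans (Finset.sum_le_sum fun a _ => hK _)

variable [DecidableEq ι]

theorem Matrix.trace_mul_eq_head_tail {Q K : Matrix ι ι ℝ} {G : Matrix ι κ ℝ} {R : Matrix μ ι ℝ}
    (hQ : Q = G * Gᵀ) (hR : 1 - Q = Rᵀ * R) (hK : K.IsSymm) {h t : ι → ℝ} (hht : h + t = 1) :
    (Q * K).trace = (diagonal h * G * (diagonal h * G)ᵀ * K).trace +
      (diagonal t * diagonal t * K).trace -
      (diagonal t * Rᵀ * (diagonal t * Rᵀ)ᵀ * K).trace +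
      2 * (Q * (diagonal t * K * diagonal h)).trace := by
  have hone : diagonal h + diagonal t = (1 : Matrix ι ι ℝ) := by
    rw [diagonal_add, ← diagonal_one]; exact congrArg diagonal hht
  have hQs : Qᵀ = Q := by rw [hQ, transpose_mul, transpose_transpose]
  set H := diagonal h with hH
  set T := diagonal t with hT
  have hHt : Hᵀ = H := diagonal_transpose h
  have hTt : Tᵀ = T := diagonal_transpose t
  have e₁ : H * G * (H * G)ᵀ = H * Q * H := by
    rw [transpose_mul, hHt, hQ]; simp only [Matrix.mul_assoc]
  have e₂ : T * Rᵀ * (T * Rᵀ)ᵀ = T * (1 - Q) * T := by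
    rw [transpose_mul, hTt, hR, transpose_transpose]; simp only [Matrix.mul_assoc]
  have e₃ : (Q * (T * K * H)).trace = (H * Q * T * K).trace := by
    rw [← mul_assoc, trace_mul_comm]; simp only [mul_assoc]
  have e₄ : (T * Q * H * K).trace = (H * Q * T * K).trace := by
    rw [← trace_transpose]
    simp only [transpose_mul, hHt, hTt, hQs, hK.eq]
    rw [trace_mul_comm]; simp only [mul_assoc]
  have e₅ : (Q * K).trace = ((H + T) * Q * (H + T) * K).trace := by rw [hone]; simp
  rw [e₅, e₁, e₂, e₃]
  simp only [mul_add, add_mul, mul_sub, sub_mul, trace_add, trace_sub, mul_one, e₄]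
  ring

/-- The deterministic part of the projection-cost bound: a spectral bound on the regularized
deviation, a bound on the tail trace and a Frobenius bound on the head-tail block suffice. -/
theorem abs_trace_mul_le_of_head_tail {σ : ι → ℝ} {lam ε k q : ℝ} (hlam : 0 < lam)
    (hε : 0 < ε) {M Q : Matrix ι ι ℝ} (hM : M.IsSymm) {G : Matrix ι κ ℝ} {R : Matrix μ ι ℝ}
    (hQ : Q = G * Gᵀ) (hR : 1 - Q = Rᵀ * R) (htr : (1 - Q).trace ≤ k)
    (hQsq : ∀ i, ∑ j, Q j i ^ 2 ≤ Q i i) (hq : q = ∑ i, σ i ^ 2 * Q i i) (hkq : k * lam ≤ q)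
    (hspec : ∀ z : ι → ℝ,
      |z ⬝ᵥ (diagonal (fun i => σ i / √(σ i ^ 2 + lam)) * M *
        diagonal (fun i => σ i / √(σ i ^ 2 + lam))) *ᵥ z| ≤ ε * (z ⬝ᵥ z))
    (htail : |∑ i, (if lam ≤ σ i ^ 2 then 0 else σ i ^ 2) * M i i| ≤ 4 / 5 * ε * (k * lam))
    (hcross : ∑ i, ∑ j, (if lam ≤ σ i ^ 2 then 1 else 0) * (if lam ≤ σ j ^ 2 then 0 else σ j ^ 2) *
      M i j ^ 2 ≤ ε ^ 2 * (k * lam)) :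
    |(Q * (diagonal σ * M * diagonal σ)).trace| ≤ 34 / 5 * ε * q := by
  set h : ι → ℝ := fun i => if lam ≤ σ i ^ 2 then 1 else 0 with hh
  set t : ι → ℝ := fun i => if lam ≤ σ i ^ 2 then 0 else 1 with ht
  set K := diagonal σ * M * diagonal σ with hK
  have hKapp : ∀ i j, K i j = σ i * M i j * σ j := fun i j => by
    rw [hK, mul_diagonal, diagonal_mul]
  have hKs : K.IsSymm := IsSymm.ext fun i j => by rw [hKapp, hKapp, hM.apply]; ring
  have hht : h + t = 1 := funext fun i => by
    by_cases hi : lam ≤ σ i ^ 2 <;> simp [hh, ht, hi]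
  have hpos : ∀ i, 0 < σ i ^ 2 + lam := fun i => by positivity
  have hspec' : ∀ y : ι → ℝ, |y ⬝ᵥ K *ᵥ y| ≤ ε * ∑ i, (σ i ^ 2 + lam) * y i ^ 2 := by
    intro y
    have hz := hspec fun i => √(σ i ^ 2 + lam) * y i
    have e₁ : (fun i => √(σ i ^ 2 + lam) * y i) ⬝ᵥ (fun i => √(σ i ^ 2 + lam) * y i) =
        ∑ i, (σ i ^ 2 + lam) * y i ^ 2 := by
      refine Finset.sum_congr rfl fun i _ => ?_
      have := Real.sq_sqrt (hpos i).le
      calc _ = √(σ i ^ 2 + lam) ^ 2 * y i ^ 2 := by ring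
        _ = _ := by rw [this]
    rw [e₁] at hz
    convert hz using 2
    simp only [dotProduct, mulVec, mul_diagonal, diagonal_mul, hKapp, Finset.mul_sum]
    refine Finset.sum_congr rfl fun i _ => Finset.sum_congr rfl fun j _ => ?_
    have hi := (Real.sqrt_pos.2 (hpos i)).ne'
    have hj := (Real.sqrt_pos.2 (hpos j)).ne'
    field_simp
  have hQnn : ∀ i, 0 ≤ Q i i := fun i =>
    (Finset.sum_nonneg fun j _ => sq_nonneg (Q j i)).trans (hQsq i)
  have hRnn : ∀ i, 0 ≤ (1 - Q) i i := fun i => by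
    rw [hR, mul_apply]
    exact Finset.sum_nonneg fun j _ => mul_self_nonneg _
  have hhead : |(diagonal h * G * (diagonal h * G)ᵀ * K).trace| ≤ 2 * ε * q := by
    refine (abs_trace_mul_transpose_mul_le hspec' _).trans ?_
    rw [hq, mul_comm 2 ε, mul_assoc, Finset.mul_sum (a := (2 : ℝ))]
    refine mul_le_mul_of_nonneg_left (Finset.sum_le_sum fun i _ => ?_) hε.le
    have e : (diagonal h * G * (diagonal h * G)ᵀ) i i = h i ^ 2 * Q i i := by
      rw [transpose_mul, diagonal_transpose, ← Matrix.mul_assoc, mul_diagonal, Matrix.mul_assoc,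
        ← hQ, diagonal_mul]
      ring
    rw [e]
    by_cases hi : lam ≤ σ i ^ 2
    · simp only [hh, hi, if_true]
      nlinarith [hQnn i]
    · simp only [hh, hi, if_false]
      have := mul_nonneg (sq_nonneg (σ i)) (hQnn i)
      linarith
  have htailR : |(diagonal t * Rᵀ * (diagonal t * Rᵀ)ᵀ * K).trace| ≤ 2 * ε * (k * lam) := by
    refine (abs_trace_mul_transpose_mul_le hspec' _).trans ?_
    calc ε * ∑ i, (σ i ^ 2 + lam) * (diagonal t * Rᵀ * (diagonal t * Rᵀ)ᵀ) i i
        ≤ ε * ∑ i, (2 * lam) * (1 - Q) i i := by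
          refine mul_le_mul_of_nonneg_left (Finset.sum_le_sum fun i _ => ?_) hε.le
          have e : (diagonal t * Rᵀ * (diagonal t * Rᵀ)ᵀ) i i = t i ^ 2 * (1 - Q) i i := by
            rw [transpose_mul, diagonal_transpose, ← Matrix.mul_assoc, mul_diagonal,
              Matrix.mul_assoc, transpose_transpose, ← hR, diagonal_mul]
            ring
          rw [e]
          by_cases hi : lam ≤ σ i ^ 2
          · simp only [ht, hi, if_true]
            have := mul_nonneg hlam.le (hRnn i)
            linarith
          · simp only [ht, hi, if_false]
            nlinarith [hRnn i]
      _ = ε * (2 * lam * (1 - Q).trace) := by rw [← Finset.mul_sum]; rfl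
      _ ≤ ε * (2 * lam * k) := by gcongr
      _ = _ := by ring
  have htt : (diagonal t * diagonal t * K).trace =
      ∑ i, (if lam ≤ σ i ^ 2 then 0 else σ i ^ 2) * M i i := by
    rw [diagonal_mul_diagonal, trace]
    refine Finset.sum_congr rfl fun i _ => ?_
    rw [diag_apply, diagonal_mul, hKapp]
    by_cases hi : lam ≤ σ i ^ 2
    · simp [ht, hi]
    · simp [ht, hi]; ring
  have hcr : |2 * (Q * (diagonal t * K * diagonal h)).trace| ≤ 2 * ε * q := by
    have e : (Q * (diagonal t * K * diagonal h)).trace =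
        ∑ i, ∑ j, (σ i * Q j i) * (h i * (t j * σ j) * M i j) := by
      rw [trace_mul_comm, trace, Finset.sum_comm]
      refine Finset.sum_congr rfl fun j _ => ?_
      rw [diag_apply, mul_apply]
      refine Finset.sum_congr rfl fun i _ => ?_
      have hQs : Q i j = Q j i := by
        have : Qᵀ = Q := by rw [hQ, transpose_mul, transpose_transpose]
        exact (congrFun (congrFun this j) i)
      rw [mul_diagonal, diagonal_mul, hKapp, hQs, hM.apply]
      ring
    have hA : ∑ i, ∑ j, (σ i * Q j i) ^ 2 ≤ q := by
      rw [hq]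
      refine Finset.sum_le_sum fun i _ => ?_
      simp only [mul_pow, ← Finset.mul_sum]
      exact mul_le_mul_of_nonneg_left (hQsq i) (sq_nonneg _)
    have hB : ∑ i, ∑ j, (h i * (t j * σ j) * M i j) ^ 2 ≤ ε ^ 2 * (k * lam) := by
      refine le_trans (le_of_eq ?_) hcross
      refine Finset.sum_congr rfl fun i _ => Finset.sum_congr rfl fun j _ => ?_
      by_cases hi : lam ≤ σ i ^ 2 <;> by_cases hj : lam ≤ σ j ^ 2 <;> simp [hh, ht, hi, hj]
      ring
    have hAG : ∀ x y : ℝ, |2 * (x * y)| ≤ ε * x ^ 2 + ε⁻¹ * y ^ 2 := fun x y => by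
      have e₁ : ε * x ^ 2 + ε⁻¹ * y ^ 2 - 2 * (x * y) = ε * (x - ε⁻¹ * y) ^ 2 := by
        field_simp; ring
      have e₂ : ε * x ^ 2 + ε⁻¹ * y ^ 2 + 2 * (x * y) = ε * (x + ε⁻¹ * y) ^ 2 := by
        field_simp; ring
      have h₁ : 0 ≤ ε * (x - ε⁻¹ * y) ^ 2 := by positivity
      have h₂ : 0 ≤ ε * (x + ε⁻¹ * y) ^ 2 := by positivity
      rw [abs_le]
      constructor <;> linarith
    calc |2 * (Q * (diagonal t * K * diagonal h)).trace|
        ≤ ∑ i, ∑ j, |2 * ((σ i * Q j i) * (h i * (t j * σ j) * M i j))| := by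
          rw [e, Finset.mul_sum]
          refine (Finset.abs_sum_le_sum_abs _ _).trans (Finset.sum_le_sum fun i _ => ?_)
          rw [Finset.mul_sum]
          exact Finset.abs_sum_le_sum_abs _ _
      _ ≤ ∑ i, ∑ j, (ε * (σ i * Q j i) ^ 2 + ε⁻¹ * (h i * (t j * σ j) * M i j) ^ 2) :=
          Finset.sum_le_sum fun i _ => Finset.sum_le_sum fun j _ => hAG _ _
      _ = ε * ∑ i, ∑ j, (σ i * Q j i) ^ 2 + ε⁻¹ * ∑ i, ∑ j, (h i * (t j * σ j) * M i j) ^ 2 := by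
          simp only [Finset.sum_add_distrib, Finset.mul_sum]
      _ ≤ ε * q + ε⁻¹ * (ε ^ 2 * (k * lam)) := by gcongr
      _ = ε * q + ε * (k * lam) := by field_simp
      _ ≤ 2 * ε * q := by nlinarith
  rw [trace_mul_eq_head_tail hQ hR hKs hht, htt]
  rw [abs_le] at hhead htailR htail hcr ⊢
  have := mul_le_mul_of_nonneg_left hkq hε.le
  constructor <;> linarith [hhead.1, hhead.2, htailR.1, htailR.2, htail.1, htail.2, hcr.1, hcr.2]

end Deterministic

section RankOneSampling

variable {n s : ℕ} {p : Fin n → ℝ} {ι : Type*}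

variable {b : Fin n → ι → ℝ} {c : ι → ℝ} {D : ℝ}

theorem smul_inv_smul_vecMulVec [Fintype ι] (hb : ∀ j, b j ⬝ᵥ b j ≤ D * p j) (j : Fin n) :
    p j • (p j)⁻¹ • vecMulVec (b j) (b j) = vecMulVec (b j) (b j) := by
  by_cases hj : p j = 0
  · have h₀ : b j ⬝ᵥ b j = 0 := le_antisymm (by simpa [hj] using hb j)
      (Finset.sum_nonneg fun i _ => mul_self_nonneg _)
    have h₁ : b j = 0 := dotProduct_self_eq_zero.1 h₀
    simp [h₁]
  · rw [smul_smul, mul_inv_cancel₀ hj, one_smul]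

variable [DecidableEq ι]

/-- The deviation of one importance sample of a sum of rank-one matrices from its mean. -/
noncomputable def sampleDev (p : Fin n → ℝ) (b : Fin n → ι → ℝ) (c : ι → ℝ) (j : Fin n) :
    Matrix ι ι ℝ :=
  (p j)⁻¹ • vecMulVec (b j) (b j) - diagonal c

theorem sampleDev_isSymm (j : Fin n) : (sampleDev p b c j).IsSymm := by
  rw [Matrix.IsSymm, sampleDev, transpose_sub, transpose_smul, transpose_vecMulVec,
    diagonal_transpose]

variable [Fintype ι]

theorem sum_smul_sampleDev (hsum : ∑ j, p j = 1) (hb : ∀ j, b j ⬝ᵥ b j ≤ D * p j)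
    (hbc : ∑ j, vecMulVec (b j) (b j) = diagonal c) : ∑ j, p j • sampleDev p b c j = 0 := by
  simp only [sampleDev, smul_sub, smul_inv_smul_vecMulVec hb, Finset.sum_sub_distrib, hbc,
    ← Finset.sum_smul, hsum, one_smul, sub_self]

theorem posSemidef_smul_diagonal_sub_sum_sampleDev_sq (hp : ∀ j, 0 ≤ p j) (hsum : ∑ j, p j = 1)
    (hD : 0 ≤ D) (hb : ∀ j, b j ⬝ᵥ b j ≤ D * p j)
    (hbc : ∑ j, vecMulVec (b j) (b j) = diagonal c) :
    (D • diagonal c - ∑ j, p j • (sampleDev p b c j * sampleDev p b c j)).PosSemidef := by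
  set B := fun j => vecMulVec (b j) (b j) with hB
  have hsq : ∀ j, p j • (sampleDev p b c j * sampleDev p b c j) =
      ((p j)⁻¹ * (b j ⬝ᵥ b j)) • B j - B j * diagonal c - diagonal c * B j +
        p j • (diagonal c * diagonal c) := by
    intro j
    have h₁ : B j * B j = (b j ⬝ᵥ b j) • B j := by
      rw [hB]; simp only [vecMulVec_mul_vecMulVec]
      ext i l; simp [vecMulVec_apply]; ring
    have h₂ : p j • (p j)⁻¹ • B j = B j := smul_inv_smul_vecMulVec hb j
    calc p j • (sampleDev p b c j * sampleDev p b c j)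
        = (p j)⁻¹ • ((p j • (p j)⁻¹ • B j) * B j) - (p j • (p j)⁻¹ • B j) * diagonal c
          - diagonal c * (p j • (p j)⁻¹ • B j) + p j • (diagonal c * diagonal c) := by
          simp only [sampleDev, sub_mul, mul_sub, smul_mul, Matrix.mul_smul, smul_sub, hB]
          simp only [smul_smul, mul_left_comm]
          abel
      _ = _ := by rw [h₂, h₁, smul_smul]
  have hkey : D • diagonal c - ∑ j, p j • (sampleDev p b c j * sampleDev p b c j) =
      ∑ j, (D - (p j)⁻¹ * (b j ⬝ᵥ b j)) • B j + diagonal c * diagonal c := by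
    simp only [hsq, Finset.sum_add_distrib, Finset.sum_sub_distrib, sub_smul, ← Finset.sum_mul,
      ← Finset.mul_sum, ← Finset.sum_smul, ← Finset.smul_sum, hsum, one_smul]
    rw [show ∑ j, B j = diagonal c from hbc]
    abel
  rw [hkey]
  refine PosSemidef.add (posSemidef_sum _ fun j _ => ?_) ?_
  · refine PosSemidef.smul (posSemidef_vecMulVec_self_star (b j)) ?_
    rcases (hp j).eq_or_lt with h | h
    · simpa [← h] using hD
    · have := hb j
      rw [sub_nonneg, inv_mul_le_iff₀ h]
      linarith
  · rw [diagonal_mul_diagonal]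
    exact PosSemidef.diagonal fun i => mul_self_nonneg _

theorem abs_quadratic_sampleDev_le (hp : ∀ j, 0 ≤ p j) (hD : 1 ≤ D)
    (hb : ∀ j, b j ⬝ᵥ b j ≤ D * p j) (hc₀ : ∀ i, 0 ≤ c i) (hc₁ : ∀ i, c i ≤ 1) (j : Fin n)
    (z : ι → ℝ) : |z ⬝ᵥ sampleDev p b c j *ᵥ z| ≤ D * (z ⬝ᵥ z) := by
  have hzz : 0 ≤ z ⬝ᵥ z := Finset.sum_nonneg fun i _ => mul_self_nonneg _
  have e : z ⬝ᵥ sampleDev p b c j *ᵥ z = (p j)⁻¹ * (b j ⬝ᵥ z) ^ 2 - ∑ i, c i * z i ^ 2 := by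
    have h₁ : z ⬝ᵥ diagonal c *ᵥ z = ∑ i, c i * z i ^ 2 :=
      Finset.sum_congr rfl fun i _ => by rw [mulVec_diagonal]; ring
    rw [sampleDev, sub_mulVec, dotProduct_sub, h₁, smul_mulVec, vecMulVec_mulVec, dotProduct_smul,
      op_smul_eq_smul, dotProduct_smul, dotProduct_comm z (b j), smul_eq_mul, smul_eq_mul, sq]
  have h₁ : 0 ≤ (p j)⁻¹ * (b j ⬝ᵥ z) ^ 2 := mul_nonneg (inv_nonneg.2 (hp j)) (sq_nonneg _)
  have h₂ : (p j)⁻¹ * (b j ⬝ᵥ z) ^ 2 ≤ D * (z ⬝ᵥ z) := by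
    rcases (hp j).eq_or_lt with h | h
    · rw [← h]; simp only [_root_.inv_zero, zero_mul]; positivity
    · rw [inv_mul_le_iff₀ h]
      have hcs : (b j ⬝ᵥ z) ^ 2 ≤ (b j ⬝ᵥ b j) * (z ⬝ᵥ z) := by
        simpa [dotProduct, sq] using Finset.sum_mul_sq_le_sq_mul_sq Finset.univ (b j) z
      nlinarith [mul_le_mul_of_nonneg_right (hb j) hzz]
  have h₃ : 0 ≤ ∑ i, c i * z i ^ 2 :=
    Finset.sum_nonneg fun i _ => mul_nonneg (hc₀ i) (sq_nonneg _)
  have h₄ : ∑ i, c i * z i ^ 2 ≤ D * (z ⬝ᵥ z) := by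
    refine le_trans (b := z ⬝ᵥ z) (Finset.sum_le_sum fun i _ => ?_) (by nlinarith)
    nlinarith [hc₁ i, sq_nonneg (z i)]
  rw [e, abs_le]
  constructor <;> linarith

theorem expec_trace_exp_sum_sampleDev_le (hp : ∀ j, 0 ≤ p j) (hsum : ∑ j, p j = 1) (hD : 1 ≤ D)
    (hb : ∀ j, b j ⬝ᵥ b j ≤ D * p j) (hbc : ∑ j, vecMulVec (b j) (b j) = diagonal c)
    (hc₀ : ∀ i, 0 ≤ c i) (hc₁ : ∀ i, c i ≤ 1) (htr : ∑ i, c i ≤ D) {η : ℝ} (hη : 0 ≤ η)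
    (hL : η * D < 3) :
    expec p (fun ω : Fin s → Fin n =>
      (NormedSpace.exp (∑ t, η • sampleDev p b c (ω t)) +
        NormedSpace.exp (-∑ t, η • sampleDev p b c (ω t)) - (2 : ℝ) • 1).trace) ≤
      2 * D * ((1 + 1 / (2 * (1 - η * D / 3)) * (η ^ 2 * D)) ^ s - 1) := by
  have hD₀ : 0 ≤ D := zero_le_one.trans hD
  have hsymm : ∀ j, (η • sampleDev p b c j).IsSymm := fun j => (sampleDev_isSymm j).smul η
  have hquad : ∀ j (z : ι → ℝ), |z ⬝ᵥ (η • sampleDev p b c j) *ᵥ z| ≤ η * D * (z ⬝ᵥ z) := by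
    intro j z
    rw [smul_mulVec, dotProduct_smul, smul_eq_mul, abs_mul, abs_of_nonneg hη, mul_assoc]
    exact mul_le_mul_of_nonneg_left (abs_quadratic_sampleDev_le hp hD hb hc₀ hc₁ j z) hη
  refine expec_trace_exp_sum_le (V := (η ^ 2 * D) • diagonal c) hp hsum hsymm ?_ ?_ (by positivity)
    (fun j => (hsymm j).posSemidef_one_add_add_sub_exp hL (hquad j)) (fun j => ?_) ?_ ?_ ?_
  · rw [← smul_zero η, ← sum_smul_sampleDev hsum hb hbc, Finset.smul_sum]
    exact Finset.sum_congr rfl fun j _ => smul_comm _ _ _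
  · have : 0 < 1 - η * D / 3 := by linarith
    positivity
  · have := (hsymm j).neg.posSemidef_one_add_add_sub_exp hL fun z => by
      simpa [neg_mulVec] using hquad j z
    simpa using this
  · have := (posSemidef_smul_diagonal_sub_sum_sampleDev_sq hp hsum hD₀ hb hbc).smul (sq_nonneg η)
    convert this using 1
    rw [smul_sub, smul_smul, Finset.smul_sum]
    congr 1
    refine Finset.sum_congr rfl fun j _ => ?_
    rw [smul_mul, Matrix.mul_smul, smul_smul η η, smul_comm (η ^ 2), sq]
  · rw [← diagonal_one, ← diagonal_smul, ← diagonal_smul, diagonal_sub]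
    refine PosSemidef.diagonal fun i => ?_
    have : 0 ≤ η ^ 2 * D * (1 - c i) := mul_nonneg (by positivity) (by linarith [hc₁ i])
    simp only [Pi.zero_apply, Pi.smul_apply, smul_eq_mul]
    linarith
  · rw [trace_smul, trace_diagonal, smul_eq_mul]
    gcongr

end RankOneSampling

section SecondMoment

variable {n s : ℕ} {p : Fin n → ℝ}

theorem expec_sq_sum_div_sub_le (hsum : ∑ j, p j = 1) {a : Fin n → ℝ}
    (ha : ∀ j, p j = 0 → a j = 0) :
    expec p (fun ω : Fin s → Fin n => (∑ t, (a (ω t) / p (ω t) - ∑ j, a j)) ^ 2) ≤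
      s * ∑ j, a j ^ 2 / p j := by
  have hmul : ∀ j, p j * (a j / p j) = a j := fun j => mul_div_cancel_of_imp' (ha j)
  rw [expec_sq_sum (f := fun j => a j / p j - ∑ j, a j) hsum]
  · refine mul_le_mul_of_nonneg_left ?_ (Nat.cast_nonneg s)
    have h : ∀ j, p j * (a j / p j - ∑ j, a j) ^ 2 =
        a j ^ 2 / p j - 2 * (∑ j, a j) * a j + (∑ j, a j) ^ 2 * p j := by
      intro j
      have h₁ : a j * (a j / p j) = a j ^ 2 / p j := by ring
      linear_combination (a j / p j - 2 * ∑ j, a j) * hmul j + h₁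
    simp only [h, Finset.sum_add_distrib, Finset.sum_sub_distrib, ← Finset.mul_sum, hsum]
    nlinarith [sq_nonneg (∑ j, a j)]
  · simp only [mul_sub, hmul, Finset.sum_sub_distrib, ← Finset.sum_mul, hsum, one_mul, sub_self]

variable {ι : Type*} {U : Matrix (Fin n) ι ℝ} {c x y : ι → ℝ} {d α β : ℝ}

theorem sum_mul_eq_one_apply [DecidableEq ι] (hU : Uᵀ * U = 1) (i l : ι) :
    ∑ j, U j i * U j l = (1 : Matrix ι ι ℝ) i l := by
  rw [← hU, mul_apply]; rfl

/-- The deviation of the Gram matrix of the sampled and rescaled rows of `U` from the identity. -/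
noncomputable def gramDev [DecidableEq ι] (p : Fin n → ℝ) (U : Matrix (Fin n) ι ℝ)
    (ω : Fin s → Fin n) : Matrix ι ι ℝ :=
  (s : ℝ)⁻¹ • ∑ t, sampleDev p U 1 (ω t)

theorem gramDev_apply [DecidableEq ι] (ω : Fin s → Fin n) (i l : ι) :
    gramDev p U ω i l =
      (s : ℝ)⁻¹ * ∑ t, (U (ω t) i * U (ω t) l / p (ω t) - (1 : Matrix ι ι ℝ) i l) := by
  simp only [gramDev, sampleDev, Matrix.smul_apply, Matrix.sum_apply, Matrix.sub_apply,
    vecMulVec_apply, smul_eq_mul, Pi.one_def, diagonal_one]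
  congr 1
  exact Finset.sum_congr rfl fun t _ => by ring

theorem gramDev_isSymm [DecidableEq ι] (ω : Fin s → Fin n) : (gramDev p U ω).IsSymm := by
  refine IsSymm.ext fun i l => ?_
  simp only [gramDev_apply, mul_comm (U _ l), Matrix.one_apply, eq_comm (a := l)]

variable [Fintype ι]

theorem apply_eq_zero_of_score_eq_zero (hc : ∀ i, 0 < c i)
    (hτ : ∀ j, ∑ i, c i * U j i ^ 2 = d * p j) {j : Fin n} (hj : p j = 0) (i : ι) : U j i = 0 := by
  have h := hτ j
  rw [hj, mul_zero, Finset.sum_eq_zero_iff_of_nonneg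
    fun i _ => mul_nonneg (hc i).le (sq_nonneg _)] at h
  simpa [(hc i).ne'] using h i (Finset.mem_univ i)

theorem sum_mul_sq_le_of_score (hτ : ∀ j, ∑ i, c i * U j i ^ 2 = d * p j)
    (hx : ∀ i, x i ≤ α * c i) (j : Fin n) : ∑ i, x i * U j i ^ 2 ≤ α * d * p j := by
  rw [mul_assoc, ← hτ, Finset.mul_sum]
  refine Finset.sum_le_sum fun i _ => ?_
  rw [← mul_assoc]
  exact mul_le_mul_of_nonneg_right (hx i) (sq_nonneg _)

variable [DecidableEq ι]

theorem sum_sum_mul_sq (hU : Uᵀ * U = 1) : ∑ j, ∑ i, x i * U j i ^ 2 = ∑ i, x i := by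
  rw [Finset.sum_comm]
  refine Finset.sum_congr rfl fun i _ => ?_
  have := sum_mul_eq_one_apply hU i i
  simp only [one_apply_eq, ← sq] at this
  rw [← Finset.mul_sum, this, mul_one]

theorem expec_sq_weighted_trace_gramDev_le (hp : ∀ j, 0 ≤ p j) (hsum : ∑ j, p j = 1)
    (hU : Uᵀ * U = 1) (hc : ∀ i, 0 < c i) (hτ : ∀ j, ∑ i, c i * U j i ^ 2 = d * p j)
    (hs : 0 < s) (hx₀ : ∀ i, 0 ≤ x i) (hx : ∀ i, x i ≤ α * c i) :
    expec p (fun ω : Fin s → Fin n => (∑ i, x i * gramDev p U ω i i) ^ 2) ≤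
      (s : ℝ)⁻¹ * (α * d * ∑ i, x i) := by
  set a : Fin n → ℝ := fun j => ∑ i, x i * U j i ^ 2 with ha
  have hs' : (s : ℝ) ≠ 0 := by positivity
  have ha₀ : ∀ j, 0 ≤ a j := fun j =>
    Finset.sum_nonneg fun i _ => mul_nonneg (hx₀ i) (sq_nonneg _)
  have hsa : ∑ j, a j = ∑ i, x i := sum_sum_mul_sq hU
  have e : ∀ ω : Fin s → Fin n, (∑ i, x i * gramDev p U ω i i) ^ 2 =
      ((s : ℝ)⁻¹) ^ 2 * (∑ t, (a (ω t) / p (ω t) - ∑ j, a j)) ^ 2 := by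
    intro ω
    rw [← mul_pow]
    congr 1
    have h : ∀ j, a j / p j - ∑ j, a j = ∑ i, x i * (U j i * U j i / p j - 1) := fun j => by
      rw [hsa, ha, Finset.sum_div, ← Finset.sum_sub_distrib]
      exact Finset.sum_congr rfl fun i _ => by ring
    simp only [gramDev_apply, one_apply_eq, h]
    rw [Finset.sum_comm, Finset.mul_sum]
    exact Finset.sum_congr rfl fun i _ => by rw [mul_left_comm, Finset.mul_sum]
  have hle : ∑ j, a j ^ 2 / p j ≤ α * d * ∑ i, x i := by
    rw [← hsa, Finset.mul_sum]
    refine Finset.sum_le_sum fun j _ => ?_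
    have h := sum_mul_sq_le_of_score hτ hx j
    rcases (hp j).eq_or_lt with hj | hj
    · have : a j = 0 := by simp [ha, apply_eq_zero_of_score_eq_zero hc hτ hj.symm]
      simp [this]
    · rw [div_le_iff₀ hj, sq]
      nlinarith [mul_le_mul_of_nonneg_left h (ha₀ j)]
  simp only [e]
  rw [expec_const_mul]
  calc ((s : ℝ)⁻¹) ^ 2 * expec p (fun ω : Fin s → Fin n =>
        (∑ t, (a (ω t) / p (ω t) - ∑ j, a j)) ^ 2)
      ≤ ((s : ℝ)⁻¹) ^ 2 * (s * (α * d * ∑ i, x i)) := by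
        gcongr
        refine (expec_sq_sum_div_sub_le hsum fun j hj => ?_).trans (by gcongr)
        simp [ha, apply_eq_zero_of_score_eq_zero hc hτ hj]
    _ = _ := by field_simp

theorem expec_weighted_sum_sq_gramDev_le (hp : ∀ j, 0 ≤ p j) (hsum : ∑ j, p j = 1)
    (hU : Uᵀ * U = 1) (hc : ∀ i, 0 < c i) (hτ : ∀ j, ∑ i, c i * U j i ^ 2 = d * p j)
    (hs : 0 < s) (hx₀ : ∀ i, 0 ≤ x i) (hy₀ : ∀ i, 0 ≤ y i) (hy : ∀ i, y i ≤ β * c i) :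
    expec p (fun ω : Fin s → Fin n => ∑ i, ∑ l, y i * x l * gramDev p U ω i l ^ 2) ≤
      (s : ℝ)⁻¹ * (β * d * ∑ i, x i) := by
  have hs' : (s : ℝ) ≠ 0 := by positivity
  have hentry : ∀ i l, y i * x l * expec p (fun ω : Fin s → Fin n => gramDev p U ω i l ^ 2) ≤
      y i * x l * ((s : ℝ)⁻¹ * ∑ j, (U j i * U j l) ^ 2 / p j) := by
    intro i l
    refine mul_le_mul_of_nonneg_left ?_ (mul_nonneg (hy₀ i) (hx₀ l))
    have h := expec_sq_sum_div_sub_le (s := s) (a := fun j => U j i * U j l) hsum fun j hj => by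
      simp [apply_eq_zero_of_score_eq_zero hc hτ hj]
    simp only [gramDev_apply, mul_pow, ← sum_mul_eq_one_apply hU] at h ⊢
    rw [expec_const_mul]
    refine (mul_le_mul_of_nonneg_left h (by positivity)).trans (le_of_eq ?_)
    field_simp
  simp only [expec_sum, expec_const_mul]
  calc ∑ i, ∑ l, y i * x l * expec p (fun ω : Fin s → Fin n => gramDev p U ω i l ^ 2)
      ≤ ∑ i, ∑ l, y i * x l * ((s : ℝ)⁻¹ * ∑ j, (U j i * U j l) ^ 2 / p j) :=
        Finset.sum_le_sum fun i _ => Finset.sum_le_sum fun l _ => hentry i l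
    _ = (s : ℝ)⁻¹ * ∑ j, (∑ i, y i * U j i ^ 2) * (∑ l, x l * U j l ^ 2) / p j := by
        simp only [Finset.sum_mul_sum, Finset.sum_div]
        simp only [Finset.mul_sum]
        rw [Finset.sum_comm (s := (Finset.univ : Finset (Fin n)))]
        refine Finset.sum_congr rfl fun i _ => ?_
        rw [Finset.sum_comm (s := (Finset.univ : Finset (Fin n)))]
        exact Finset.sum_congr rfl fun l _ => Finset.sum_congr rfl fun j _ => by ring
    _ ≤ (s : ℝ)⁻¹ * ∑ j, β * d * ∑ l, x l * U j l ^ 2 := by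
        gcongr with j _
        have h := sum_mul_sq_le_of_score hτ hy j
        have h₀ : 0 ≤ ∑ l, x l * U j l ^ 2 :=
          Finset.sum_nonneg fun i _ => mul_nonneg (hx₀ i) (sq_nonneg _)
        rcases (hp j).eq_or_lt with hj | hj
        · simp [apply_eq_zero_of_score_eq_zero hc hτ hj.symm]
        · rw [div_le_iff₀ hj]
          nlinarith [mul_le_mul_of_nonneg_right h h₀]
    _ = _ := by rw [← Finset.mul_sum, sum_sum_mul_sq hU]

end SecondMoment

section RidgeSampling

variable {n s : ℕ} {p : Fin n → ℝ} {ι : Type*} [Fintype ι] [DecidableEq ι]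

theorem diagonal_mul_gramDev_mul_diagonal (U : Matrix (Fin n) ι ℝ) (w : ι → ℝ)
    (ω : Fin s → Fin n) :
    diagonal w * gramDev p U ω * diagonal w =
      (s : ℝ)⁻¹ • ∑ t, sampleDev p (fun j i => w i * U j i) (fun i => w i ^ 2) (ω t) := by
  rw [gramDev, Matrix.mul_smul, smul_mul, Finset.mul_sum, Finset.sum_mul]
  congr 1
  refine Finset.sum_congr rfl fun t _ => ?_
  ext i l
  rw [mul_diagonal, diagonal_mul]
  simp only [sampleDev, Matrix.sub_apply, Matrix.smul_apply, vecMulVec_apply, smul_eq_mul]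
  by_cases h : i = l
  · subst h; simp; ring
  · simp [h]; ring

theorem exists_expec_le_of_spectral (hp : ∀ j, 0 ≤ p j) (hsum : ∑ j, p j = 1)
    {U : Matrix (Fin n) ι ℝ} (hU : Uᵀ * U = 1) {w : ι → ℝ} (hw : ∀ i, w i ^ 2 ≤ 1) {k ε δ : ℝ}
    (hk : 1 ≤ k) (hτ : ∀ j, ∑ i, w i ^ 2 * U j i ^ 2 ≤ 2 * k * p j)
    (hd : ∑ i, w i ^ 2 ≤ 2 * k) (hε : 0 < ε) (hε1 : ε < 1) (hδ : 0 < δ) (hδ1 : δ < 1) (hs : 0 < s)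
    (hbig : (1 + ε / 3) * (4 * k * Real.log (16 * (1 + 2 * k) / δ)) / ε ^ 2 ≤ s) :
    ∃ f : (Fin s → Fin n) → ℝ, (∀ ω, 0 ≤ f ω) ∧ expec p f ≤ 4 / 15 * δ ∧
      ∀ ω, f ω < 1 → ∀ z : ι → ℝ,
        |z ⬝ᵥ (diagonal w * gramDev p U ω * diagonal w) *ᵥ z| ≤ ε * (z ⬝ᵥ z) := by
  have hk₀ : 0 < k := by linarith
  have hs' : (0 : ℝ) < s := by positivity
  set η := ε / (2 * k * (1 + ε / 3)) with hη
  have hη₀ : 0 < η := by positivity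
  set y := ε ^ 2 * s / (4 * k * (1 + ε / 3)) with hy
  have hylog : Real.log (16 * (1 + 2 * k) / δ) ≤ y := by
    rw [hy, le_div_iff₀ (by positivity)]
    rw [div_le_iff₀ (by positivity)] at hbig
    linarith
  have hypos : 0 < y := by positivity
  have hexp : 16 * (1 + 2 * k) / δ ≤ Real.exp y := by
    rwa [← Real.log_le_iff_le_exp (by positivity)]
  rw [div_le_iff₀ hδ] at hexp
  have hηD : η * (2 * k) = ε / (1 + ε / 3) := by rw [hη]; field_simp
  have hL : η * (2 * k) < 3 := by
    rw [hηD, div_lt_iff₀ (by positivity)]; linarith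
  have hyη : η * s * ε = 2 * y := by rw [hη, hy]; field_simp; ring
  set b : Fin n → ι → ℝ := fun j i => w i * U j i with hb
  set c : ι → ℝ := fun i => w i ^ 2 with hc
  have hbc : ∑ j, vecMulVec (b j) (b j) = diagonal c := by
    ext i l
    rw [Matrix.sum_apply]
    have h := sum_mul_eq_one_apply hU i l
    calc ∑ j, vecMulVec (b j) (b j) i l = w i * w l * ∑ j, U j i * U j l := by
          rw [Finset.mul_sum]
          exact Finset.sum_congr rfl fun j _ => by simp only [hb, vecMulVec_apply]; ring
      _ = diagonal c i l := by
          rw [h]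
          by_cases hil : i = l
          · subst hil; simp [hc]; ring
          · simp [hil]
  have hbb : ∀ j, b j ⬝ᵥ b j ≤ 2 * k * p j := fun j => by
    refine le_trans (le_of_eq ?_) (hτ j)
    exact Finset.sum_congr rfl fun i _ => by simp only [hb]; ring
  set a := Real.exp (2 * y) + Real.exp (-(2 * y)) - 2 with ha
  have hone : 1 ≤ Real.exp y := Real.one_le_exp hypos.le
  have ha' : (Real.exp y - 1) ^ 2 ≤ a := by
    have h₁ : Real.exp (2 * y) = Real.exp y ^ 2 := by rw [← Real.exp_nat_mul]; norm_num
    have h₂ := Real.exp_pos (-(2 * y))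
    have h₃ : 16 ≤ Real.exp y := by nlinarith
    rw [ha, h₁]; nlinarith
  have hgt : 15 * k ≤ δ * (Real.exp y - 1) := by nlinarith
  have hey : 0 < Real.exp y - 1 := by
    by_contra! h
    nlinarith
  have ha₀ : 0 < a := lt_of_lt_of_le (by positivity) ha'
  set S : (Fin s → Fin n) → Matrix ι ι ℝ := fun ω => ∑ t, η • sampleDev p b c (ω t) with hS
  have hSsymm : ∀ ω, (S ω).IsSymm := fun ω => by
    rw [Matrix.IsSymm, hS, transpose_sum]
    exact Finset.sum_congr rfl fun t _ => ((sampleDev_isSymm _).smul η).eq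
  set F : (Fin s → Fin n) → ℝ := fun ω =>
    (NormedSpace.exp (S ω) + NormedSpace.exp (-S ω) - (2 : ℝ) • 1).trace with hF
  have hEF : expec p F ≤ 4 / 15 * δ * a := by
    have h := expec_trace_exp_sum_sampleDev_le (s := s) hp hsum (by linarith) hbb hbc
      (fun i => sq_nonneg (w i)) hw hd hη₀.le hL
    have hgv : 1 / (2 * (1 - η * (2 * k) / 3)) * (η ^ 2 * (2 * k)) = y / s := by
      have h₁ : 1 - η * (2 * k) / 3 = 1 / (1 + ε / 3) := by rw [hηD]; field_simp; ring
      rw [h₁, hη, hy]; field_simp; ring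
    rw [hgv] at h
    have hpow : (1 + y / s) ^ s ≤ Real.exp y := by
      calc (1 + y / s) ^ s ≤ Real.exp (y / s) ^ s := by
            refine pow_le_pow_left₀ (by positivity) ?_ s
            linarith [Real.add_one_le_exp (y / s)]
        _ = Real.exp y := by rw [← Real.exp_nat_mul]; congr 1; field_simp
    calc expec p F ≤ 2 * (2 * k) * ((1 + y / s) ^ s - 1) := h
      _ ≤ 2 * (2 * k) * (Real.exp y - 1) := by gcongr
      _ ≤ 4 / 15 * δ * (Real.exp y - 1) ^ 2 := by nlinarith
      _ ≤ _ := by gcongr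
  refine ⟨fun ω => a⁻¹ * F ω, fun ω => ?_, ?_, fun ω hω z => ?_⟩
  · exact mul_nonneg (by positivity) (hSsymm ω).posSemidef_exp_add_exp_neg_sub_two.trace_nonneg
  · rw [expec_const_mul, inv_mul_le_iff₀ ha₀]; linarith
  · have hlt : F ω < a := by rwa [inv_mul_lt_iff₀ ha₀, mul_one] at hω
    have hquad := ((hSsymm ω).quadratic_le_or_le_trace_exp (by positivity)).resolve_right
      (not_le.2 hlt) z
    have hSω : S ω = (η * s) • (diagonal w * gramDev p U ω * diagonal w) := by
      rw [diagonal_mul_gramDev_mul_diagonal, smul_smul, mul_assoc, mul_inv_cancel₀ hs'.ne',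
        mul_one, Finset.smul_sum]
    rw [hSω, smul_mulVec, dotProduct_smul, smul_eq_mul, abs_mul,
      abs_of_pos (by positivity : 0 < η * s), ← hyη, mul_assoc (η * s)] at hquad
    exact le_of_mul_le_mul_left hquad (by positivity)

/-- With probability at least `1 - δ`, ridge leverage score sampling gives a spectral bound on the
regularized deviation, a bound on the tail trace and a Frobenius bound on the head-tail block. -/
theorem one_sub_le_probOf_of_head_tail (hp : ∀ j, 0 ≤ p j) (hsum : ∑ j, p j = 1)
    {U : Matrix (Fin n) ι ℝ} (hU : Uᵀ * U = 1) {σ : ι → ℝ} (hσ : ∀ i, 0 < σ i)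
    {lam k d ε δ : ℝ} (hlam : 0 < lam) (hk : 1 ≤ k)
    (hτ : ∀ j, ∑ i, σ i ^ 2 / (σ i ^ 2 + lam) * U j i ^ 2 = d * p j)
    (hsumd : ∑ i, σ i ^ 2 / (σ i ^ 2 + lam) = d) (hd : d ≤ 2 * k)
    (htail : ∑ i, (if lam ≤ σ i ^ 2 then 0 else σ i ^ 2) ≤ 2 * (k * lam))
    (hε : 0 < ε) (hε1 : ε < 1) (hδ : 0 < δ) (hδ1 : δ < 1) (hs : 0 < s)
    (hbig : (1 + ε / 3) * (4 * k * Real.log (16 * (1 + 2 * k) / δ)) / ε ^ 2 ≤ s)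
    (hbig' : 32 * k / (δ * ε ^ 2) ≤ s) {E : (Fin s → Fin n) → Prop}
    (hE : ∀ ω : Fin s → Fin n,
      (∀ z : ι → ℝ, |z ⬝ᵥ (diagonal (fun i => σ i / √(σ i ^ 2 + lam)) * gramDev p U ω *
        diagonal (fun i => σ i / √(σ i ^ 2 + lam))) *ᵥ z| ≤ ε * (z ⬝ᵥ z)) →
      |∑ i, (if lam ≤ σ i ^ 2 then 0 else σ i ^ 2) * gramDev p U ω i i| ≤
        4 / 5 * ε * (k * lam) →
      ∑ i, ∑ j, (if lam ≤ σ i ^ 2 then 1 else 0) * (if lam ≤ σ j ^ 2 then 0 else σ j ^ 2) *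
        gramDev p U ω i j ^ 2 ≤ ε ^ 2 * (k * lam) → E ω) :
    1 - δ ≤ probOf p E := by
  have hk₀ : 0 < k := by linarith
  have hs' : (0 : ℝ) < s := by positivity
  have hpos : ∀ i, 0 < σ i ^ 2 + lam := fun i => by positivity
  have hw : ∀ i, (σ i / √(σ i ^ 2 + lam)) ^ 2 = σ i ^ 2 / (σ i ^ 2 + lam) := fun i => by
    rw [div_pow, Real.sq_sqrt (hpos i).le]
  have hc : ∀ i, 0 < σ i ^ 2 / (σ i ^ 2 + lam) := fun i => div_pos (pow_pos (hσ i) 2) (hpos i)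
  obtain ⟨f, hf₀, hfE, hf⟩ := exists_expec_le_of_spectral (s := s) (p := p)
    (w := fun i => σ i / √(σ i ^ 2 + lam)) hp hsum hU
    (fun i => by rw [hw, div_le_one (hpos i)]; linarith) hk
    (fun j => by simp only [hw, hτ]; exact mul_le_mul_of_nonneg_right hd (hp j))
    (by simpa only [hw, hsumd] using hd) hε hε1 hδ hδ1 hs hbig
  set x : ι → ℝ := fun i => if lam ≤ σ i ^ 2 then 0 else σ i ^ 2 with hx
  set y : ι → ℝ := fun i => if lam ≤ σ i ^ 2 then 1 else 0 with hy
  have hx₀ : ∀ i, 0 ≤ x i := fun i => by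
    by_cases h : lam ≤ σ i ^ 2 <;> simp [hx, h, sq_nonneg]
  have hy₀ : ∀ i, 0 ≤ y i := fun i => by by_cases h : lam ≤ σ i ^ 2 <;> simp [hy, h]
  have hxc : ∀ i, x i ≤ 2 * lam * (σ i ^ 2 / (σ i ^ 2 + lam)) := fun i => by
    rw [mul_div_assoc', le_div_iff₀ (hpos i)]
    have := sq_nonneg (σ i)
    by_cases h : lam ≤ σ i ^ 2
    · simp only [hx, h, if_true]; rw [zero_mul]; positivity
    · simp only [hx, h, if_false]
      nlinarith
  have hyc : ∀ i, y i ≤ 2 * (σ i ^ 2 / (σ i ^ 2 + lam)) := fun i => by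
    rw [mul_div_assoc', le_div_iff₀ (hpos i)]
    by_cases h : lam ≤ σ i ^ 2
    · simp only [hy, h, if_true]; linarith
    · simp only [hy, h, if_false]; rw [zero_mul]; positivity
  have hdx : d * ∑ i, x i ≤ 2 * k * (2 * (k * lam)) :=
    mul_le_mul hd htail (Finset.sum_nonneg fun i _ => hx₀ i) (by positivity)
  have hks : (s : ℝ)⁻¹ * (32 * k) ≤ δ * ε ^ 2 := by
    rw [div_le_iff₀ (by positivity)] at hbig'
    rw [inv_mul_le_iff₀ hs']
    linarith
  set g₂ : (Fin s → Fin n) → ℝ := fun ω => (∑ i, x i * gramDev p U ω i i) ^ 2 with hg₂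
  set g₃ : (Fin s → Fin n) → ℝ := fun ω => ∑ i, ∑ j, y i * x j * gramDev p U ω i j ^ 2 with hg₃
  have h₂ : expec p g₂ ≤ δ * ε ^ 2 * (k * lam) ^ 2 / 4 :=
    calc expec p g₂ ≤ (s : ℝ)⁻¹ * (2 * lam * d * ∑ i, x i) :=
          expec_sq_weighted_trace_gramDev_le hp hsum hU hc hτ hs hx₀ hxc
      _ = (s : ℝ)⁻¹ * (2 * lam) * (d * ∑ i, x i) := by ring
      _ ≤ (s : ℝ)⁻¹ * (2 * lam) * (2 * k * (2 * (k * lam))) := by gcongr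
      _ = (s : ℝ)⁻¹ * (32 * k) * (k * lam ^ 2 / 4) := by ring
      _ ≤ δ * ε ^ 2 * (k * (k * lam ^ 2) / 4) := by
          refine mul_le_mul hks ?_ (by positivity) (by positivity)
          have : 0 < k * lam ^ 2 := by positivity
          nlinarith
      _ = _ := by ring
  have h₃ : expec p g₃ ≤ δ * ε ^ 2 * (k * lam) / 4 :=
    calc expec p g₃ ≤ (s : ℝ)⁻¹ * (2 * d * ∑ i, x i) :=
          expec_weighted_sum_sq_gramDev_le hp hsum hU hc hτ hs hx₀ hy₀ hyc
      _ = (s : ℝ)⁻¹ * 2 * (d * ∑ i, x i) := by ring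
      _ ≤ (s : ℝ)⁻¹ * 2 * (2 * k * (2 * (k * lam))) := by gcongr
      _ = (s : ℝ)⁻¹ * (32 * k) * (k * lam / 4) := by ring
      _ ≤ δ * ε ^ 2 * (k * lam / 4) := by gcongr
      _ = _ := by ring
  have ha₂ : 0 < (4 / 5 * ε * (k * lam)) ^ 2 := by positivity
  have ha₃ : 0 < ε ^ 2 * (k * lam) := by positivity
  have hg₂₀ : ∀ ω, 0 ≤ ((4 / 5 * ε * (k * lam)) ^ 2)⁻¹ * g₂ ω := fun ω => by positivity
  have hg₃₀ : ∀ ω, 0 ≤ (ε ^ 2 * (k * lam))⁻¹ * g₃ ω := fun ω =>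
    mul_nonneg (by positivity) <| Finset.sum_nonneg fun i _ => Finset.sum_nonneg fun j _ =>
      mul_nonneg (mul_nonneg (hy₀ i) (hx₀ j)) (sq_nonneg _)
  refine le_trans ?_ (one_sub_expec_le_probOf (f := fun ω => f ω +
    (((4 / 5 * ε * (k * lam)) ^ 2)⁻¹ * g₂ ω + (ε ^ 2 * (k * lam))⁻¹ * g₃ ω)) hp hsum
    (fun ω => add_nonneg (hf₀ ω) (add_nonneg (hg₂₀ ω) (hg₃₀ ω))) fun ω hω => ?_)
  · rw [expec_add, expec_add, expec_const_mul, expec_const_mul]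
    have h₂' : ((4 / 5 * ε * (k * lam)) ^ 2)⁻¹ * expec p g₂ ≤ 25 / 64 * δ := by
      rw [inv_mul_le_iff₀ ha₂]; linarith
    have h₃' : (ε ^ 2 * (k * lam))⁻¹ * expec p g₃ ≤ 1 / 4 * δ := by
      rw [inv_mul_le_iff₀ ha₃]; linarith
    linarith
  · have hω₁ : f ω < 1 := by linarith [hg₂₀ ω, hg₃₀ ω]
    have hω₂ : ((4 / 5 * ε * (k * lam)) ^ 2)⁻¹ * g₂ ω < 1 := by linarith [hf₀ ω, hg₃₀ ω]
    have hω₃ : (ε ^ 2 * (k * lam))⁻¹ * g₃ ω < 1 := by linarith [hf₀ ω, hg₂₀ ω]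
    rw [inv_mul_lt_iff₀ ha₂, mul_one] at hω₂
    rw [inv_mul_lt_iff₀ ha₃, mul_one] at hω₃
    exact hE ω (hf ω hω₁) (abs_le_of_sq_le_sq hω₂.le (by positivity)) hω₃.le

end RidgeSampling

section ProjectionCost

theorem transpose_mul_self_samplingMatrix_mul {ι : Type*} [DecidableEq ι] {n s : ℕ}
    {p : Fin n → ℝ} (hp : ∀ j, 0 ≤ p j) (hs : 0 < s) (U : Matrix (Fin n) ι ℝ) (ω : Fin s → Fin n) :
    (samplingMatrix p s ω * U)ᵀ * (samplingMatrix p s ω * U) = 1 + gramDev p U ω := by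
  have hs' : (s : ℝ) ≠ 0 := by positivity
  have hrow : ∀ t i, (samplingMatrix p s ω * U) t i = 1 / √(s * p (ω t)) * U (ω t) i := by
    intro t i
    simp [mul_apply, samplingMatrix]
  ext i l
  rw [mul_apply, Matrix.add_apply, gramDev_apply, Finset.sum_sub_distrib, Finset.sum_const,
    Finset.card_univ, Fintype.card_fin, nsmul_eq_mul, mul_sub, inv_mul_cancel_left₀ hs',
    add_sub_cancel, Finset.mul_sum]
  refine Finset.sum_congr rfl fun t _ => ?_
  rw [transpose_apply, hrow, hrow]
  have h := Real.mul_self_sqrt (mul_nonneg s.cast_nonneg (hp (ω t)))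
  calc 1 / √(s * p (ω t)) * U (ω t) i * (1 / √(s * p (ω t)) * U (ω t) l)
      = 1 / (√(s * p (ω t)) * √(s * p (ω t))) * (U (ω t) i * U (ω t) l) := by ring
    _ = _ := by rw [h]; ring

variable {ι κ μ : Type*} [Fintype ι] [Fintype κ] [Fintype μ]

theorem frobNorm_sq (M : Matrix μ κ ℝ) : frobNorm M ^ 2 = (Mᵀ * M).trace := by
  have h : 0 ≤ ∑ i, ∑ j, M i j ^ 2 :=
    Finset.sum_nonneg fun i _ => Finset.sum_nonneg fun j _ => sq_nonneg (M i j)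
  rw [frobNorm, Real.sq_sqrt h, Finset.sum_comm, trace]
  refine Finset.sum_congr rfl fun j _ => ?_
  rw [diag_apply, mul_apply]
  exact Finset.sum_congr rfl fun i _ => by rw [transpose_apply, sq]

theorem frobNorm_mul_diagonal_mul_sq [DecidableEq ι] (B : Matrix μ ι ℝ) (σ : ι → ℝ)
    (G : Matrix ι κ ℝ) :
    frobNorm (B * diagonal σ * G) ^ 2 =
      (G * Gᵀ * (diagonal σ * (Bᵀ * B) * diagonal σ)).trace := by
  rw [frobNorm_sq, transpose_mul, transpose_mul, diagonal_transpose, Matrix.mul_assoc Gᵀ,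
    trace_mul_comm, Matrix.mul_assoc G, trace_mul_comm G]
  simp only [Matrix.mul_assoc]
  rw [trace_mul_comm Gᵀ]
  simp only [Matrix.mul_assoc]

theorem trace_mul_diagonal_mul_diagonal [DecidableEq ι] (Q : Matrix ι ι ℝ) (σ : ι → ℝ) :
    (Q * (diagonal σ * diagonal σ)).trace = ∑ i, σ i ^ 2 * Q i i := by
  rw [diagonal_mul_diagonal, trace]
  exact Finset.sum_congr rfl fun i _ => by rw [diag_apply, mul_diagonal]; ring

variable [DecidableEq ι] [DecidableEq κ] [DecidableEq μ]

theorem transpose_mul_self_one_sub_mul_transpose {V : Matrix μ ι ℝ} (hV : Vᵀ * V = 1) :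
    (1 - V * Vᵀ)ᵀ * (1 - V * Vᵀ) = 1 - V * Vᵀ := by
  have h : V * Vᵀ * (V * Vᵀ) = V * Vᵀ := by
    rw [Matrix.mul_assoc, ← Matrix.mul_assoc Vᵀ, hV, Matrix.one_mul]
  rw [transpose_sub, transpose_one, transpose_mul, transpose_transpose, mul_sub, sub_mul, sub_mul,
    one_mul, mul_one, one_mul, h, sub_self, sub_zero]

theorem posSemidef_one_sub_mul_transpose {V : Matrix μ ι ℝ} (hV : Vᵀ * V = 1) :
    (1 - V * Vᵀ).PosSemidef := by
  rw [← transpose_mul_self_one_sub_mul_transpose hV, ← conjTranspose_eq_transpose_of_trivial]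
  exact posSemidef_conjTranspose_mul_self _

theorem one_sub_transpose_mul_mul_transpose {ν : Type*} [DecidableEq ν] {V : Matrix μ ν ℝ}
    {X : Matrix μ κ ℝ} (hV : Vᵀ * V = 1) (hX : Xᵀ * X = 1) :
    1 - Vᵀ * X * (Vᵀ * X)ᵀ = ((1 - X * Xᵀ) * V)ᵀ * ((1 - X * Xᵀ) * V) := by
  have h : ((1 - X * Xᵀ) * V)ᵀ * ((1 - X * Xᵀ) * V) =
      Vᵀ * ((1 - X * Xᵀ)ᵀ * (1 - X * Xᵀ)) * V := by
    rw [transpose_mul (1 - X * Xᵀ)]; simp only [Matrix.mul_assoc]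
  rw [h, transpose_mul_self_one_sub_mul_transpose hX, Matrix.mul_sub, Matrix.sub_mul,
    Matrix.mul_one, hV, transpose_mul, transpose_transpose]
  simp only [Matrix.mul_assoc]

theorem sum_sq_le_apply_self_of_isometry {V : Matrix μ ι ℝ} {X : Matrix μ κ ℝ}
    (hV : Vᵀ * V = 1) (hX : Xᵀ * X = 1) (i : ι) :
    ∑ j, (Vᵀ * X * (Vᵀ * X)ᵀ) j i ^ 2 ≤ (Vᵀ * X * (Vᵀ * X)ᵀ) i i := by
  set G := Vᵀ * X with hG
  have h : 1 - Gᵀ * G = ((1 - V * Vᵀ) * X)ᵀ * ((1 - V * Vᵀ) * X) := by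
    have := one_sub_transpose_mul_mul_transpose hX hV
    rw [← this, hG]
    simp only [transpose_mul, transpose_transpose]
  clear_value G
  generalize (1 - V * Vᵀ) * X = Z at h
  have hdiff : G * Gᵀ - (G * Gᵀ)ᵀ * (G * Gᵀ) = (Z * Gᵀ)ᵀ * (Z * Gᵀ) := by
    have e : (Z * Gᵀ)ᵀ * (Z * Gᵀ) = G * (Zᵀ * Z) * Gᵀ := by
      rw [transpose_mul, transpose_transpose]; simp only [Matrix.mul_assoc]
    rw [e, ← h, Matrix.mul_sub, Matrix.sub_mul, Matrix.mul_one, transpose_mul G,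
      transpose_transpose]
    simp only [Matrix.mul_assoc]
  have hii := congrFun (congrFun hdiff i) i
  rw [Matrix.sub_apply, mul_apply (M := (G * Gᵀ)ᵀ), mul_apply (M := (Z * Gᵀ)ᵀ)] at hii
  have h₁ : 0 ≤ ∑ j, (Z * Gᵀ)ᵀ i j * (Z * Gᵀ) j i :=
    Finset.sum_nonneg fun j _ => mul_self_nonneg _
  have h₂ : ∑ j, (G * Gᵀ)ᵀ i j * (G * Gᵀ) j i = ∑ j, (G * Gᵀ) j i ^ 2 :=
    Finset.sum_congr rfl fun j _ => by rw [transpose_apply, sq]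
  linarith

theorem trace_one_sub_le_of_isometry {V : Matrix μ ι ℝ} {X : Matrix μ κ ℝ}
    (hV : Vᵀ * V = 1) (hX : Xᵀ * X = 1) :
    (1 - Vᵀ * X * (Vᵀ * X)ᵀ).trace ≤ (Fintype.card μ : ℝ) - Fintype.card κ := by
  have h := (posSemidef_one_sub_mul_transpose hV).trace_mul_nonneg
    (posSemidef_one_sub_mul_transpose hX)
  have e₁ : (V * Vᵀ).trace = Fintype.card ι := by rw [trace_mul_comm, hV, trace_one]
  have e₂ : (X * Xᵀ).trace = Fintype.card κ := by rw [trace_mul_comm, hX, trace_one]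
  have e₃ : (V * Vᵀ * (X * Xᵀ)).trace = (Vᵀ * X * (Vᵀ * X)ᵀ).trace := by
    rw [Matrix.mul_assoc, trace_mul_comm, transpose_mul, transpose_transpose]
    simp only [Matrix.mul_assoc]
  rw [sub_mul, one_mul, mul_sub, mul_one, trace_sub, trace_sub, trace_sub, e₁, e₂, e₃,
    trace_one] at h
  rw [trace_sub, trace_one]
  linarith

end ProjectionCost

section SingularValueTail

variable {r k : ℕ} {σ : Fin r → ℝ} {lam : ℝ}

theorem sum_ite_val_lt (hkr : k < r) (a : ℝ) :
    ∑ i : Fin r, (if (i : ℕ) < k then a else 0) = k * a := by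
  rw [← Finset.sum_filter, Finset.sum_const, nsmul_eq_mul]
  congr 2
  rw [Fin.card_filter_val_lt, min_eq_right hkr.le]

theorem sum_ite_val_lt_le_of_sum_le (hσdec : ∀ i j : Fin r, i ≤ j → σ j ≤ σ i)
    (hσpos : ∀ i, 0 < σ i) (hkr : k < r) {c : Fin r → ℝ} (hc₀ : ∀ i, 0 ≤ c i) (hc₁ : ∀ i, c i ≤ 1)
    (hc : ∑ i, c i ≤ k) :
    ∑ i : Fin r, (if (i : ℕ) < k then 0 else σ i ^ 2) ≤ ∑ i, σ i ^ 2 * (1 - c i) := by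
  set m := σ ⟨k, hkr⟩ ^ 2 with hm
  have hterm : ∀ i : Fin r, (if (i : ℕ) < k then 0 else σ i ^ 2) +
      ((if (i : ℕ) < k then m else 0) - m * c i) ≤ σ i ^ 2 * (1 - c i) := by
    intro i
    have h₀ := hc₀ i
    have h₁ := hc₁ i
    by_cases hi : (i : ℕ) < k
    · have : m ≤ σ i ^ 2 := pow_le_pow_left₀ (hσpos _).le (hσdec i ⟨k, hkr⟩ hi.le) 2
      simp only [hi, if_true]
      nlinarith
    · have : σ i ^ 2 ≤ m := pow_le_pow_left₀ (hσpos _).le (hσdec ⟨k, hkr⟩ i (not_lt.1 hi)) 2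
      simp only [hi, if_false]
      nlinarith
  have h := Finset.sum_le_sum fun i (_ : i ∈ Finset.univ) => hterm i
  rw [Finset.sum_add_distrib, Finset.sum_sub_distrib, sum_ite_val_lt hkr, ← Finset.mul_sum] at h
  nlinarith [sq_nonneg (σ ⟨k, hkr⟩)]

theorem sum_div_add_le_two_mul (hkr : k < r) (hlam : 0 < lam)
    (htail : ∑ i : Fin r, (if (i : ℕ) < k then 0 else σ i ^ 2) = k * lam) :
    ∑ i, σ i ^ 2 / (σ i ^ 2 + lam) ≤ 2 * k := by
  have hterm : ∀ i : Fin r, σ i ^ 2 / (σ i ^ 2 + lam) ≤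
      (if (i : ℕ) < k then 1 else 0) + lam⁻¹ * (if (i : ℕ) < k then 0 else σ i ^ 2) := by
    intro i
    have h := sq_nonneg (σ i)
    rw [div_le_iff₀ (by positivity)]
    by_cases hi : (i : ℕ) < k
    · simp only [hi, if_true]; linarith
    · simp only [hi, if_false]
      have : lam⁻¹ * lam = 1 := inv_mul_cancel₀ hlam.ne'
      have h₁ : 0 ≤ lam⁻¹ * (σ i ^ 2) ^ 2 := by positivity
      nlinarith
  refine (Finset.sum_le_sum fun i _ => hterm i).trans (le_of_eq ?_)
  rw [Finset.sum_add_distrib, ← Finset.mul_sum, htail, sum_ite_val_lt hkr]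
  field_simp
  ring

theorem sum_ite_le_two_mul (hkr : k < r) (hlam : 0 < lam)
    (htail : ∑ i : Fin r, (if (i : ℕ) < k then 0 else σ i ^ 2) = k * lam) :
    ∑ i, (if lam ≤ σ i ^ 2 then 0 else σ i ^ 2) ≤ 2 * (k * lam) := by
  have hterm : ∀ i : Fin r, (if lam ≤ σ i ^ 2 then 0 else σ i ^ 2) ≤
      (if (i : ℕ) < k then lam else 0) + (if (i : ℕ) < k then 0 else σ i ^ 2) := by
    intro i
    have h := sq_nonneg (σ i)
    split_ifs <;> linarith
  refine (Finset.sum_le_sum fun i _ => hterm i).trans (le_of_eq ?_)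
  rw [Finset.sum_add_distrib, htail, sum_ite_val_lt hkr]
  ring

end SingularValueTail

/-- ridge leverage score sampling yields a projection-cost preserving
sketch with error (4 + 2√2)ε. -/
theorem stmt_18 {n d r : ℕ} {k : ℕ} (s : ℕ) (hs : 0 < s)
    (A : Matrix (Fin n) (Fin d) ℝ)
    (U : Matrix (Fin n) (Fin r) ℝ) (V : Matrix (Fin d) (Fin r) ℝ) (σ : Fin r → ℝ)
    (hU : Uᵀ * U = 1) (hV : Vᵀ * V = 1)
    (hσdec : ∀ i j : Fin r, i ≤ j → σ j ≤ σ i) (hσpos : ∀ i, 0 < σ i)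
    (hA : A = U * Matrix.diagonal σ * Vᵀ) (hrank : A.rank = r)
    (hk1 : 1 ≤ k) (hkr : k < r)
    (lam : ℝ) (hlam : lam = frobNorm (A - U * truncDiag σ k * Vᵀ) ^ 2 / k)
    (p : Fin n → ℝ)
    (hpdef : ∀ i, p i = (∑ j, ((U * ridgeDiag σ lam) i j) ^ 2)
        / (∑ i', ∑ j, ((U * ridgeDiag σ lam) i' j) ^ 2))
    (ε δ : ℝ) (hε0 : 0 < ε) (hε1 : ε < 1) (hδ0 : 0 < δ) (hδ1 : δ < 1)
    (hsbig : (s : ℝ) ≥ max ((1 + ε / 3) * (4 * k * Real.log (16 * (1 + 2 * k) / δ)) / ε ^ 2)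
        (32 * k / (δ * ε ^ 2))) :
    probOf p (fun (ω : Fin s → Fin n) =>
      ∀ X : Matrix (Fin d) (Fin (d - k)) ℝ, Xᵀ * X = 1 →
        |frobNorm (samplingMatrix p s ω * A * X) ^ 2 - frobNorm (A * X) ^ 2|
          ≤ (4 + 2 * Real.sqrt 2) * ε * frobNorm (A * X) ^ 2)
    ≥ 1 - δ := by
  have hk : (1 : ℝ) ≤ k := by exact_mod_cast hk1
  have hk₀ : (0 : ℝ) < k := by linarith
  have hrd : r ≤ d := hrank ▸ A.rank_le_width
  have hkd : k ≤ d := (hkr.trans_le hrd).le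
  have htail : ∑ i : Fin r, (if (i : ℕ) < k then 0 else σ i ^ 2) = k * lam := by
    have hsub : A - U * truncDiag σ k * Vᵀ =
        U * diagonal (fun i : Fin r => if (i : ℕ) < k then 0 else σ i) * Vᵀ := by
      rw [hA, truncDiag, ← Matrix.sub_mul, ← Matrix.mul_sub, diagonal_sub]
      congr 3
      funext i
      split_ifs <;> simp
    rw [hlam, hsub, frobNorm_mul_diagonal_mul_sq, transpose_transpose, hV, hU, Matrix.mul_one,
      trace_mul_diagonal_mul_diagonal, mul_div_cancel₀ _ hk₀.ne']
    refine Finset.sum_congr rfl fun i _ => ?_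
    split_ifs <;> simp
  have hlam₀ : 0 < lam := by
    have h : 0 < ∑ i : Fin r, (if (i : ℕ) < k then 0 else σ i ^ 2) := by
      refine Finset.sum_pos' (fun i _ => ?_) ⟨⟨k, hkr⟩, Finset.mem_univ _, ?_⟩
      · split_ifs
        exacts [le_rfl, sq_nonneg _]
      · simpa using pow_pos (hσpos ⟨k, hkr⟩) 2
    rw [htail] at h
    exact pos_of_mul_pos_right h hk₀.le
  have hscore : ∀ j, ∑ i, ((U * ridgeDiag σ lam) j i) ^ 2 =
      ∑ i, σ i ^ 2 / (σ i ^ 2 + lam) * U j i ^ 2 := fun j => by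
    refine Finset.sum_congr rfl fun i _ => ?_
    rw [ridgeDiag, mul_diagonal, mul_pow, div_pow, Real.sq_sqrt (by positivity)]
    ring
  simp only [hscore, sum_sum_mul_sq hU] at hpdef
  set D := ∑ i, σ i ^ 2 / (σ i ^ 2 + lam) with hD
  have hc : ∀ i, 0 < σ i ^ 2 / (σ i ^ 2 + lam) := fun i =>
    div_pos (pow_pos (hσpos i) 2) (by positivity)
  have hD₀ : 0 < D := Finset.sum_pos (fun i _ => hc i) ⟨⟨k, hkr⟩, Finset.mem_univ _⟩
  have hp : ∀ j, 0 ≤ p j := fun j => by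
    rw [hpdef]
    exact div_nonneg (Finset.sum_nonneg fun i _ => mul_nonneg (hc i).le (sq_nonneg _)) hD₀.le
  have hsum : ∑ j, p j = 1 := by
    simp only [hpdef]
    rw [← Finset.sum_div, sum_sum_mul_sq hU, div_self hD₀.ne']
  have hτ : ∀ j, ∑ i, σ i ^ 2 / (σ i ^ 2 + lam) * U j i ^ 2 = D * p j := fun j => by
    rw [hpdef, mul_div_cancel₀ _ hD₀.ne']
  refine one_sub_le_probOf_of_head_tail hp hsum hU hσpos hlam₀ hk hτ hD.symm
    (sum_div_add_le_two_mul hkr hlam₀ htail) (sum_ite_le_two_mul hkr hlam₀ htail) hε0 hε1 hδ0 hδ1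
    hs ((le_max_left _ _).trans hsbig) ((le_max_right _ _).trans hsbig)
    fun ω hspec htrace hcross X hX => ?_
  set G := Vᵀ * X with hG
  set Q := G * Gᵀ with hQ
  set M := gramDev p U ω with hM
  have hR : 1 - Q = ((1 - X * Xᵀ) * V)ᵀ * ((1 - X * Xᵀ) * V) :=
    one_sub_transpose_mul_mul_transpose hV hX
  have htr : (1 - Q).trace ≤ k := by
    have h := trace_one_sub_le_of_isometry hV hX
    rw [Fintype.card_fin, Fintype.card_fin, Nat.cast_sub hkd] at h
    linarith
  have hQsq : ∀ i, ∑ j, Q j i ^ 2 ≤ Q i i := sum_sq_le_apply_self_of_isometry hV hX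
  have hAX : frobNorm (A * X) ^ 2 = ∑ i, σ i ^ 2 * Q i i := by
    rw [hA, Matrix.mul_assoc _ Vᵀ, frobNorm_mul_diagonal_mul_sq, hU, Matrix.mul_one,
      trace_mul_diagonal_mul_diagonal]
  have hWAX : frobNorm (samplingMatrix p s ω * A * X) ^ 2 =
      frobNorm (A * X) ^ 2 + (Q * (diagonal σ * M * diagonal σ)).trace := by
    have e : samplingMatrix p s ω * A * X = samplingMatrix p s ω * U * diagonal σ * G := by
      rw [hA]; simp only [Matrix.mul_assoc, hG]
    rw [e, frobNorm_mul_diagonal_mul_sq, transpose_mul_self_samplingMatrix_mul hp hs, hAX,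
      ← trace_mul_diagonal_mul_diagonal, ← trace_add, Matrix.mul_add, Matrix.add_mul,
      Matrix.mul_one, Matrix.mul_add]
  have hkq : k * lam ≤ frobNorm (A * X) ^ 2 := by
    have hdiag : ∀ i, (1 - Q) i i = 1 - Q i i := fun i => by rw [Matrix.sub_apply, one_apply_eq]
    have h := sum_ite_val_lt_le_of_sum_le hσdec hσpos hkr (c := fun i => (1 - Q) i i)
      (fun i => by rw [hR, mul_apply]; exact Finset.sum_nonneg fun j _ => mul_self_nonneg _)
      (fun i => by
        have := (Finset.sum_nonneg fun j _ => sq_nonneg (Q j i)).trans (hQsq i)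
        rw [hdiag]; linarith) htr
    simp only [hdiag, sub_sub_cancel] at h
    rwa [hAX, ← htail]
  have hmain := abs_trace_mul_le_of_head_tail hlam₀ hε0 (gramDev_isSymm ω) hQ hR htr hQsq hAX hkq
    hspec htrace hcross
  rw [hWAX, add_sub_cancel_left]
  refine hmain.trans ?_
  have hsqrt : (7 / 5 : ℝ) ≤ √2 := Real.le_sqrt_of_sq_le (by norm_num)
  gcongr
  linarith
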